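/- arXiv:2208.13526 — 13 statements merged into one kernel-verified Lean document; each statement's English description precedes it below -/
import Mathlib

section
/- For any probability distribution P on (Fin 2)³ of GHZ type, i.e. P(0,0,0) = x, P(1,1,1) = 1 − x for some real x with 0 < x < 1, and P(a,b,c) = 0 for all other triples, there exists no probability distribution Q on (Fin 2)³ (nonnegative, summing to 1) satisfying simultaneously: (i) Q_{AB}(a,b) = P_{AB}(a,b) for all a,b; (ii) Q_{BC}(b,c) = P_{BC}(b,c) for all b,c; and (iii) Q_{AC}(a,c) = P_A(a)·P_C(c) for all a,c. (That is, GHZ-type patterns are signaling-enabling in the triangle network.) -/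
/-- GHZ-type patterns are signaling-enabling in the triangle network:
no distribution `Q` on `(Fin 2)³` reproduces the `AB` and `BC` marginals of a
GHZ-type `P` while factorizing on `AC`. -/
theorem ghz_signaling_enabling
    (P : Fin 2 → Fin 2 → Fin 2 → ℝ) (x : ℝ)
    (hx0 : 0 < x) (hx1 : x < 1)
    (h000 : P 0 0 0 = x) (h111 : P 1 1 1 = 1 - x)
    (hother : ∀ a b c : Fin 2,
      ¬(a = 0 ∧ b = 0 ∧ c = 0) → ¬(a = 1 ∧ b = 1 ∧ c = 1) → P a b c = 0) :
    ¬ ∃ Q : Fin 2 → Fin 2 → Fin 2 → ℝ,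
      (∀ a b c, 0 ≤ Q a b c) ∧
      (∑ a, ∑ b, ∑ c, Q a b c) = 1 ∧
      (∀ a b, (∑ c, Q a b c) = ∑ c, P a b c) ∧
      (∀ b c, (∑ a, Q a b c) = ∑ a, P a b c) ∧
      (∀ a c, (∑ b, Q a b c) =
        (∑ b, ∑ c', P a b c') * (∑ a', ∑ b, P a' b c)) := by
  rintro ⟨Q, hQ, -, hAB, hBC, hAC⟩
  have h001 : P 0 0 1 = 0 := hother 0 0 1 (by decide) (by decide)
  have h010 : P 0 1 0 = 0 := hother 0 1 0 (by decide) (by decide)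
  have h011 : P 0 1 1 = 0 := hother 0 1 1 (by decide) (by decide)
  have h101 : P 1 0 1 = 0 := hother 1 0 1 (by decide) (by decide)
  have hAB01 := hAB 0 1
  have hBC01 := hBC 0 1
  have hAC01 := hAC 0 1
  simp only [Fin.sum_univ_two, h000, h111, h001, h010, h011, h101, add_zero, zero_add]
    at hAB01 hBC01 hAC01
  have hpos : 0 < x * (1 - x) := mul_pos hx0 (sub_pos.2 hx1)
  linarith [hQ 0 1 0, hQ 1 0 1]
end

section
/- Every triangle-local probability distribution P on (Fin 2)³ satisfies the cut inequality P_A(0)·P_C(1) ≤ P_{AB}(0,1) + P_{BC}(0,1). -/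
/-- `P` is a local probability distribution in the triangle network: the three
sources are finite independent hidden variables, processed by stochastic
response kernels at the three observers. -/
def IsTriangleLocal (P : Fin 2 → Fin 2 → Fin 2 → ℝ) : Prop :=
  ∃ (nα nβ nγ : ℕ)
    (pα : Fin nα → ℝ) (pβ : Fin nβ → ℝ) (pγ : Fin nγ → ℝ)
    (PA : Fin 2 → Fin nβ → Fin nγ → ℝ)
    (PB : Fin 2 → Fin nγ → Fin nα → ℝ)
    (PC : Fin 2 → Fin nα → Fin nβ → ℝ),
    (∀ α, 0 ≤ pα α) ∧ (∑ α, pα α) = 1 ∧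
    (∀ β, 0 ≤ pβ β) ∧ (∑ β, pβ β) = 1 ∧
    (∀ γ, 0 ≤ pγ γ) ∧ (∑ γ, pγ γ) = 1 ∧
    (∀ a β γ, 0 ≤ PA a β γ) ∧ (∀ β γ, (∑ a, PA a β γ) = 1) ∧
    (∀ b γ α, 0 ≤ PB b γ α) ∧ (∀ γ α, (∑ b, PB b γ α) = 1) ∧
    (∀ c α β, 0 ≤ PC c α β) ∧ (∀ α β, (∑ c, PC c α β) = 1) ∧
    (∀ a b c, P a b c =
      ∑ α, ∑ β, ∑ γ, pα α * pβ β * pγ γ * PA a β γ * PB b γ α * PC c α β)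

theorem mul_le_mul_add_mul_of_add_eq_one {x y z w : ℝ} (hx0 : 0 ≤ x) (hx1 : x ≤ 1)
    (hy0 : 0 ≤ y) (hy1 : y ≤ 1) (hz : 0 ≤ z) (hw : 0 ≤ w) (hwz : w + z = 1) :
    x * y ≤ x * z + w * y := by
  have h₁ : x * z * y ≤ x * z := mul_le_of_le_one_right (mul_nonneg hx0 hz) hy1
  have h₂ : x * (w * y) ≤ w * y := mul_le_of_le_one_left (mul_nonneg hw hy0) hx1
  have h₃ : x * y = x * z * y + x * (w * y) := by
    linear_combination -(x * y) * hwz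
  linarith

theorem sum_mul_mem_Icc_of_sum_eq_one {ι : Type*} [Fintype ι] {p f : ι → ℝ}
    (hp : ∀ i, 0 ≤ p i) (hp1 : ∑ i, p i = 1) (hf : ∀ i, f i ∈ Set.Icc (0 : ℝ) 1) :
    ∑ i, p i * f i ∈ Set.Icc (0 : ℝ) 1 :=
  ⟨Finset.sum_nonneg fun i _ => mul_nonneg (hp i) (hf i).1,
    hp1 ▸ Finset.sum_le_sum fun i _ => mul_le_of_le_one_right (hp i) (hf i).2⟩

/-- Every triangle-local distribution satisfies the cut inequality
`P_A(0)·P_C(1) ≤ P_AB(0,1) + P_BC(0,1)`. -/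
theorem triangle_local_cut_inequality
    (P : Fin 2 → Fin 2 → Fin 2 → ℝ) (hP : IsTriangleLocal P) :
    (∑ b, ∑ c, P 0 b c) * (∑ a, ∑ b, P a b 1) ≤
      (∑ c, P 0 1 c) + (∑ a, P a 0 1) := by
  obtain ⟨nα, nβ, nγ, pα, pβ, pγ, PA, PB, PC, hα, hα1, hβ, hβ1, hγ, hγ1,
    hA, hA1, hB, hB1, hC, hC1, hP⟩ := hP
  simp only [Fin.sum_univ_two] at hA1 hB1 hC1
  -- Average each outer response over the source `β` that the two observers share.
  set a : Fin nγ → ℝ := fun γ => ∑ β, pβ β * PA 0 β γ with ha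
  set c : Fin nα → ℝ := fun α => ∑ β, pβ β * PC 1 α β with hc
  have ha01 (γ) : a γ ∈ Set.Icc (0 : ℝ) 1 := sum_mul_mem_Icc_of_sum_eq_one hβ hβ1
    fun β => ⟨hA 0 β γ, by linarith [hA1 β γ, hA 1 β γ]⟩
  have hc01 (α) : c α ∈ Set.Icc (0 : ℝ) 1 := sum_mul_mem_Icc_of_sum_eq_one hβ hβ1
    fun β => ⟨hC 1 α β, by linarith [hC1 α β, hC 0 α β]⟩
  have hAB (b) : ∑ k, P 0 b k = ∑ α, ∑ γ, pα α * pγ γ * (a γ * PB b γ α) := by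
    simp only [hP, Fin.sum_univ_two, ← Finset.sum_add_distrib]
    refine Finset.sum_congr rfl fun α _ => ?_
    rw [Finset.sum_comm]
    refine Finset.sum_congr rfl fun γ _ => ?_
    simp only [ha, Finset.sum_mul, Finset.mul_sum]
    refine Finset.sum_congr rfl fun β _ => ?_
    linear_combination pα α * pβ β * pγ γ * PA 0 β γ * PB b γ α * hC1 α β
  have hBC (b) : ∑ k, P k b 1 = ∑ α, ∑ γ, pα α * pγ γ * (PB b γ α * c α) := by
    simp only [hP, Fin.sum_univ_two, ← Finset.sum_add_distrib]
    refine Finset.sum_congr rfl fun α _ => ?_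
    rw [Finset.sum_comm]
    refine Finset.sum_congr rfl fun γ _ => ?_
    simp only [hc, Finset.mul_sum]
    refine Finset.sum_congr rfl fun β _ => ?_
    linear_combination pα α * pβ β * pγ γ * PB b γ α * PC 1 α β * hA1 β γ
  have hPA : ∑ b, ∑ k, P 0 b k = ∑ γ, pγ γ * a γ := by
    calc ∑ b, ∑ k, P 0 b k = ∑ α, ∑ γ, pα α * (pγ γ * a γ) := by
          simp only [hAB, Fin.sum_univ_two, ← Finset.sum_add_distrib]
          refine Finset.sum_congr rfl fun α _ => Finset.sum_congr rfl fun γ _ => ?_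
          linear_combination pα α * pγ γ * a γ * hB1 γ α
      _ = ∑ γ, pγ γ * a γ := by simp only [← Finset.mul_sum, ← Finset.sum_mul, hα1, one_mul]
  have hPC : ∑ k, ∑ b, P k b 1 = ∑ α, pα α * c α := by
    rw [Finset.sum_comm]
    calc ∑ b, ∑ k, P k b 1 = ∑ α, ∑ γ, pα α * c α * pγ γ := by
          simp only [hBC, Fin.sum_univ_two, ← Finset.sum_add_distrib]
          refine Finset.sum_congr rfl fun α _ => Finset.sum_congr rfl fun γ _ => ?_
          linear_combination pα α * pγ γ * c α * hB1 γ α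
      _ = ∑ α, pα α * c α := by simp only [← Finset.mul_sum, hγ1, mul_one]
  rw [hPA, hPC, hAB, hBC, mul_comm, Finset.sum_mul_sum]
  simp only [← Finset.sum_add_distrib]
  refine Finset.sum_le_sum fun α _ => Finset.sum_le_sum fun γ _ => ?_
  calc pα α * c α * (pγ γ * a γ) = pα α * pγ γ * (a γ * c α) := by ring
    _ ≤ pα α * pγ γ * (a γ * PB 1 γ α + PB 0 γ α * c α) :=
        mul_le_mul_of_nonneg_left
          (mul_le_mul_add_mul_of_add_eq_one (ha01 γ).1 (ha01 γ).2 (hc01 α).1 (hc01 α).2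
            (hB 1 γ α) (hB 0 γ α) (hB1 γ α))
          (mul_nonneg (hα α) (hγ γ))
    _ = _ := mul_add _ _ _
end

section
/- For any probability distribution P on (Fin 2)³ of GHZ type, i.e. P(0,0,0) = x, P(1,1,1) = 1 − x with 0 < x < 1 and P(a,b,c) = 0 otherwise, one has P_A(0)·P_C(1) > P_{AB}(0,1) + P_{BC}(0,1); consequently P is not triangle-local. -/
/-- Cut inequality: removing the source shared by `A` and `C` makes these observers independent
while preserving the marginals on `A`, `B` and on `B`, `C`. -/
theorem IsTriangleLocal.cut_inequality {P : Fin 2 → Fin 2 → Fin 2 → ℝ} (hP : IsTriangleLocal P) :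
    (∑ b, ∑ c, P 0 b c) * (∑ a, ∑ b, P a b 1) ≤ (∑ c, P 0 1 c) + (∑ a, P a 0 1) := by
  obtain ⟨nα, nβ, nγ, pα, pβ, pγ, PA, PB, PC, hα, sα, hβ, sβ, hγ, sγ,
    hA, sA, hB, sB, hC, sC, h⟩ := hP
  simp only [Fin.sum_univ_two] at sA sB sC
  set f : Fin nγ → ℝ := fun γ => ∑ β, pβ β * PA 0 β γ with hf
  set g : Fin nα → ℝ := fun α => ∑ β, pβ β * PC 1 α β with hg
  have f_nonneg (γ) : 0 ≤ f γ := Finset.sum_nonneg fun β _ => mul_nonneg (hβ β) (hA 0 β γ)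
  have g_nonneg (α) : 0 ≤ g α := Finset.sum_nonneg fun β _ => mul_nonneg (hβ β) (hC 1 α β)
  have f_le_one (γ) : f γ ≤ 1 := by
    rw [← sβ]
    exact Finset.sum_le_sum fun β _ =>
      mul_le_of_le_one_right (hβ β) (by linarith [hA 1 β γ, sA β γ])
  have g_le_one (α) : g α ≤ 1 := by
    rw [← sβ]
    exact Finset.sum_le_sum fun β _ =>
      mul_le_of_le_one_right (hβ β) (by linarith [hC 0 α β, sC α β])
  have marginal_AB (b : Fin 2) :
      ∑ c, P 0 b c = ∑ α, ∑ γ, pα α * pγ γ * (f γ * PB b γ α) := by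
    simp only [h, Fin.sum_univ_two, ← Finset.sum_add_distrib, ← mul_add, sC, mul_one]
    refine Finset.sum_congr rfl fun α _ => ?_
    rw [Finset.sum_comm]
    refine Finset.sum_congr rfl fun γ _ => ?_
    simp only [hf, Finset.sum_mul, Finset.mul_sum]
    exact Finset.sum_congr rfl fun β _ => by ring
  have marginal_BC (b : Fin 2) :
      ∑ a, P a b 1 = ∑ α, ∑ γ, pα α * pγ γ * (g α * PB b γ α) := by
    simp only [h, Fin.sum_univ_two, ← Finset.sum_add_distrib, ← mul_add, ← add_mul, sA, mul_one]
    refine Finset.sum_congr rfl fun α _ => ?_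
    rw [Finset.sum_comm]
    refine Finset.sum_congr rfl fun γ _ => ?_
    simp only [hg, Finset.sum_mul, Finset.mul_sum]
    exact Finset.sum_congr rfl fun β _ => by ring
  have marginal_A : ∑ b, ∑ c, P 0 b c = ∑ γ, pγ γ * f γ := by
    simp only [marginal_AB]
    simp only [Fin.sum_univ_two, ← Finset.sum_add_distrib, ← mul_add, sB, mul_one]
    simp only [mul_assoc, ← Finset.mul_sum]
    rw [← Finset.sum_mul, sα, one_mul]
  have marginal_C : ∑ a, ∑ b, P a b 1 = ∑ α, pα α * g α := by
    rw [Finset.sum_comm]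
    simp only [marginal_BC]
    simp only [Fin.sum_univ_two, ← Finset.sum_add_distrib, ← mul_add, sB, mul_one]
    refine Finset.sum_congr rfl fun α _ => ?_
    rw [← Finset.sum_mul, ← Finset.mul_sum, sγ, mul_one]
  rw [marginal_A, marginal_C, marginal_AB, marginal_BC, mul_comm, Finset.sum_mul_sum,
    ← Finset.sum_add_distrib]
  refine Finset.sum_le_sum fun α _ => ?_
  rw [← Finset.sum_add_distrib]
  refine Finset.sum_le_sum fun γ _ => ?_
  calc pα α * g α * (pγ γ * f γ)
      = pα α * pγ γ * (g α * (f γ * PB 1 γ α) + f γ * (g α * PB 0 γ α)) := by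
        linear_combination -(pα α * g α * pγ γ * f γ) * sB γ α
    _ ≤ pα α * pγ γ * (f γ * PB 1 γ α + g α * PB 0 γ α) :=
        mul_le_mul_of_nonneg_left
          (add_le_add
            (mul_le_of_le_one_left (mul_nonneg (f_nonneg γ) (hB 1 γ α)) (g_le_one α))
            (mul_le_of_le_one_left (mul_nonneg (g_nonneg α) (hB 0 γ α)) (f_le_one γ)))
          (mul_nonneg (hα α) (hγ γ))
    _ = pα α * pγ γ * (f γ * PB 1 γ α) + pα α * pγ γ * (g α * PB 0 γ α) := mul_add _ _ _

/-- GHZ-type distributions violate the cut inequality, hence are not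
triangle-local. -/
theorem ghz_violates_cut_inequality
    (P : Fin 2 → Fin 2 → Fin 2 → ℝ) (x : ℝ)
    (hx0 : 0 < x) (hx1 : x < 1)
    (h000 : P 0 0 0 = x) (h111 : P 1 1 1 = 1 - x)
    (hother : ∀ a b c : Fin 2,
      ¬(a = 0 ∧ b = 0 ∧ c = 0) → ¬(a = 1 ∧ b = 1 ∧ c = 1) → P a b c = 0) :
    (∑ b, ∑ c, P 0 b c) * (∑ a, ∑ b, P a b 1) >
      (∑ c, P 0 1 c) + (∑ a, P a 0 1) ∧
    ¬ IsTriangleLocal P := by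
  have violation : (∑ b, ∑ c, P 0 b c) * (∑ a, ∑ b, P a b 1) >
      (∑ c, P 0 1 c) + (∑ a, P a 0 1) := by
    simpa [Fin.sum_univ_two, h000, h111, hother] using mul_pos hx0 (sub_pos.mpr hx1)
  exact ⟨violation, fun hP => hP.cut_inequality.not_gt violation⟩
end

section
/- Every triangle-local probability distribution P on (Fin 2)³ satisfies the polynomial inequality I₂ = P_{AC}(1,1)·P_A(0) + P_{BC}(1,0)·P_B(0) − P_{AB}(0,1)·P_{AB}(1,0) ≥ 0. -/
/-- A product of two weighted sums over `T`, after reindexing the pairs by a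
permutation `e` that preserves the weights. -/
theorem sum_mul_sum_eq_sum_equiv {T : Type*} [Fintype T] (w f g : T → ℝ) (e : T × T ≃ T × T)
    (hw : ∀ q, w (e q).1 * w (e q).2 = w q.1 * w q.2) :
    (∑ t, w t * f t) * (∑ t, w t * g t)
      = ∑ q : T × T, w q.1 * w q.2 * (f (e q).1 * g (e q).2) := by
  rw [Fintype.sum_mul_sum, ← Fintype.sum_prod_type', ← e.sum_comp]
  refine Finset.sum_congr rfl fun q _ => ?_
  rw [← hw q]
  ring

/-- Exchange the first coordinates of two triples. -/
def swapFst (X Y Z : Type*) : (X × Y × Z) × (X × Y × Z) ≃ (X × Y × Z) × (X × Y × Z) where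
  toFun q := ((q.2.1, q.1.2), (q.1.1, q.2.2))
  invFun q := ((q.2.1, q.1.2), (q.1.1, q.2.2))
  left_inv _ := rfl
  right_inv _ := rfl

/-- Exchange the second coordinates of two triples. -/
def swapSnd (X Y Z : Type*) : (X × Y × Z) × (X × Y × Z) ≃ (X × Y × Z) × (X × Y × Z) where
  toFun q := ((q.1.1, q.2.2.1, q.1.2.2), (q.2.1, q.1.2.1, q.2.2.2))
  invFun q := ((q.1.1, q.2.2.1, q.1.2.2), (q.2.1, q.1.2.1, q.2.2.2))
  left_inv _ := rfl
  right_inv _ := rfl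

/-- If `c₀ + c₁ = 1`, a product of four numbers in `[0, 1]` is split by `c` and each part is
bounded by dropping one factor. -/
theorem mul_four_le_of_add_eq_one {x y x' y' c₀ c₁ : ℝ} (hx : 0 ≤ x) (hx1 : x ≤ 1) (hy : 0 ≤ y)
    (hy1 : y ≤ 1) (hx' : 0 ≤ x') (hx1' : x' ≤ 1) (hy' : 0 ≤ y') (hy1' : y' ≤ 1)
    (hc₀ : 0 ≤ c₀) (hc₁ : 0 ≤ c₁) (hc : c₀ + c₁ = 1) :
    x * y * (x' * y') ≤ x' * c₁ * x + y * c₀ * y' := by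
  have h₁ : x' * c₁ * x * (y * y') ≤ x' * c₁ * x :=
    mul_le_of_le_one_right (by positivity) (mul_le_one₀ hy1 hy' hy1')
  have h₀ : y * c₀ * y' * (x * x') ≤ y * c₀ * y' :=
    mul_le_of_le_one_right (by positivity) (mul_le_one₀ hx1 hx' hx1')
  calc x * y * (x' * y') = x * y * (x' * y') * (c₀ + c₁) := by rw [hc, mul_one]
    _ = x' * c₁ * x * (y * y') + y * c₀ * y' * (x * x') := by ring
    _ ≤ _ := add_le_add h₁ h₀

/-- Every triangle-local distribution satisfies the polynomial inequality
`I₂ = P_AC(1,1)·P_A(0) + P_BC(1,0)·P_B(0) − P_AB(0,1)·P_AB(1,0) ≥ 0`. -/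
theorem triangle_local_I2
    (P : Fin 2 → Fin 2 → Fin 2 → ℝ) (hP : IsTriangleLocal P) :
    (∑ b, P 1 b 1) * (∑ b, ∑ c, P 0 b c)
      + (∑ a, P a 1 0) * (∑ a, ∑ c, P a 0 c)
      - (∑ c, P 0 1 c) * (∑ c, P 1 0 c) ≥ 0 := by
  obtain ⟨nα, nβ, nγ, pα, pβ, pγ, PA, PB, PC, hα, -, hβ, -, hγ, -, hA, hA1, hB, hB1, hC, hC1,
    hP⟩ := hP
  have le_one {f : Fin 2 → ℝ} (hf : ∀ i, 0 ≤ f i) (h : ∑ i, f i = 1) (i : Fin 2) : f i ≤ 1 :=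
    h ▸ Finset.single_le_sum (fun j _ => hf j) (Finset.mem_univ i)
  let T := Fin nα × Fin nβ × Fin nγ
  let w : T → ℝ := fun t => pα t.1 * pβ t.2.1 * pγ t.2.2
  let A : Fin 2 → T → ℝ := fun a t => PA a t.2.1 t.2.2
  let B : Fin 2 → T → ℝ := fun b t => PB b t.2.2 t.1
  let C : Fin 2 → T → ℝ := fun c t => PC c t.1 t.2.1
  have hA1 (t : T) : ∑ a, A a t = 1 := hA1 _ _
  have hB1 (t : T) : ∑ b, B b t = 1 := hB1 _ _
  have hC1 (t : T) : ∑ c, C c t = 1 := hC1 _ _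
  have hP (a b c) : P a b c = ∑ t, w t * (A a t * B b t * C c t) := by
    simp only [hP, T, w, A, B, C, Fintype.sum_prod_type, mul_assoc]
  have hAB (a b) : ∑ c, P a b c = ∑ t, w t * (A a t * B b t) := by
    simp_rw [hP]
    rw [Finset.sum_comm]
    simp_rw [← Finset.mul_sum, hC1, mul_one]
  have hAC (a c) : ∑ b, P a b c = ∑ t, w t * (A a t * C c t) := by
    simp_rw [hP]
    rw [Finset.sum_comm]
    simp_rw [← Finset.mul_sum, ← Finset.sum_mul, ← Finset.mul_sum, hB1, mul_one]
  have hBC (b c) : ∑ a, P a b c = ∑ t, w t * (B b t * C c t) := by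
    simp_rw [hP]
    rw [Finset.sum_comm]
    simp_rw [← Finset.mul_sum, ← Finset.sum_mul, hA1, one_mul]
  have hPA (a) : ∑ b, ∑ c, P a b c = ∑ t, w t * A a t := by
    simp_rw [hAB]
    rw [Finset.sum_comm]
    simp_rw [← Finset.mul_sum, hB1, mul_one]
  have hPB (b) : ∑ a, ∑ c, P a b c = ∑ t, w t * B b t := by
    simp_rw [hAB]
    rw [Finset.sum_comm]
    simp_rw [← Finset.mul_sum, ← Finset.sum_mul, hA1, one_mul]
  have hw (t : T) : 0 ≤ w t := mul_nonneg (mul_nonneg (hα _) (hβ _)) (hγ _)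
  rw [hAC, hBC, hAB, hAB, hPA, hPB, ge_iff_le, sub_nonneg,
    sum_mul_sum_eq_sum_equiv w _ _ (Equiv.refl _) (fun _ => rfl),
    sum_mul_sum_eq_sum_equiv w _ _ ((Equiv.prodComm T T).trans (swapFst _ _ _))
      (fun q => by simp only [w, swapFst, Equiv.trans_apply, Equiv.coe_fn_mk,
        Equiv.prodComm_apply, Prod.fst_swap, Prod.snd_swap]; ring),
    sum_mul_sum_eq_sum_equiv w _ _ (swapSnd _ _ _)
      (fun q => by simp only [w, swapSnd, Equiv.coe_fn_mk]; ring),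
    ← Finset.sum_add_distrib]
  refine Finset.sum_le_sum fun q _ => ?_
  rw [← mul_add]
  refine mul_le_mul_of_nonneg_left ?_ (mul_nonneg (hw _) (hw _))
  have hA0 (a) (t : T) : 0 ≤ A a t := hA _ _ _
  have hB0 (b) (t : T) : 0 ≤ B b t := hB _ _ _
  have hAle (a) (t : T) : A a t ≤ 1 := le_one (hA0 · t) (hA1 t) a
  have hBle (b) (t : T) : B b t ≤ 1 := le_one (hB0 · t) (hB1 t) b
  exact mul_four_le_of_add_eq_one (hA0 0 q.1) (hAle 0 q.1) (hB0 1 q.1) (hBle 1 q.1)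
    (hA0 1 q.2) (hAle 1 q.2) (hB0 0 q.2) (hBle 0 q.2) (hC 0 q.1.1 q.2.2.1) (hC 1 q.1.1 q.2.2.1)
    ((Fin.sum_univ_two _).symm.trans (hC1 (q.1.1, q.2.2.1, q.1.2.2)))
end

section
/- Every triangle-local probability distribution P on (Fin 2)³ satisfies the polynomial inequality I₃ = P_{AC}(0,0)·P_{AC}(1,1) + P_{BC}(0,1)·P_B(1) + P_{BC}(1,0)·P_{BC}(0,0) − P_{AB}(0,1)·P_{AB}(1,0) ≥ 0. -/
/-- Products of two source averages, after exchanging the two copies of the first source. -/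
theorem sum_mul_sum_swap_fst {ι κ : Type*} [Fintype ι] [Fintype κ]
    (f g : ι × κ → ℝ) :
    (∑ t, f t) * (∑ t, g t) = ∑ p : (ι × κ) × (ι × κ), f (p.2.1, p.1.2) * g (p.1.1, p.2.2) := by
  rw [Finset.sum_mul_sum, ← Fintype.sum_prod_type']
  let e : (ι × κ) × (ι × κ) ≃ (ι × κ) × (ι × κ) :=
    { toFun := fun p => ((p.2.1, p.1.2), (p.1.1, p.2.2))
      invFun := fun p => ((p.2.1, p.1.2), (p.1.1, p.2.2))
      left_inv := fun _ => rfl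
      right_inv := fun _ => rfl }
  exact (e.sum_comp fun p => f p.1 * g p.2).symm

/-- Products of two source averages, after exchanging the two copies of the second source. -/
theorem sum_mul_sum_swap_snd {ι κ τ : Type*} [Fintype ι] [Fintype κ] [Fintype τ]
    (f g : ι × κ × τ → ℝ) :
    (∑ t, f t) * (∑ t, g t) =
      ∑ p : (ι × κ × τ) × (ι × κ × τ),
        f (p.1.1, p.2.2.1, p.1.2.2) * g (p.2.1, p.1.2.1, p.2.2.2) := by
  rw [Finset.sum_mul_sum, ← Fintype.sum_prod_type']
  let e : (ι × κ × τ) × (ι × κ × τ) ≃ (ι × κ × τ) × (ι × κ × τ) :=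
    { toFun := fun p => ((p.1.1, p.2.2.1, p.1.2.2), (p.2.1, p.1.2.1, p.2.2.2))
      invFun := fun p => ((p.1.1, p.2.2.1, p.1.2.2), (p.2.1, p.1.2.1, p.2.2.2))
      left_inv := fun _ => rfl
      right_inv := fun _ => rfl }
  exact (e.sum_comp fun p => f p.1 * g p.2).symm

/-- Split the event with probability `a * b * a' * b'` according to two binary outcomes with
probabilities `c, 1 - c` and `c', 1 - c'`. -/
theorem mul_le_of_split_outcomes {a a' b b' c₀ c₁ c₀' c₁' : ℝ}
    (ha : 0 ≤ a) (ha1 : a ≤ 1) (ha' : 0 ≤ a') (ha1' : a' ≤ 1)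
    (hb : 0 ≤ b) (hb1 : b ≤ 1) (hb' : 0 ≤ b') (hb1' : b' ≤ 1)
    (hc₀ : 0 ≤ c₀) (hc₁ : 0 ≤ c₁) (hc : c₀ + c₁ = 1)
    (hc₀' : 0 ≤ c₀') (hc₁' : 0 ≤ c₁') (hc' : c₀' + c₁' = 1) :
    (a * b) * (a' * b') ≤
      (a * c₀') * (a' * c₁) + (b' * c₁') * b + (b * c₀) * (b' * c₀') := by
  have haa : a * a' ≤ 1 := mul_le_one₀ ha1 ha' ha1'
  have hbb : b * b' ≤ 1 := mul_le_one₀ hb1 hb' hb1'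
  have h₁ : a * a' * (b * b' * c₁') ≤ b * b' * c₁' :=
    mul_le_of_le_one_left (by positivity) haa
  have h₂ : b * b' * (a * a' * (c₀' * c₁)) ≤ a * a' * (c₀' * c₁) :=
    mul_le_of_le_one_left (by positivity) hbb
  have h₃ : a * a' * (b * b' * (c₀' * c₀)) ≤ b * b' * (c₀' * c₀) :=
    mul_le_of_le_one_left (by positivity) haa
  have hsplit : c₁' + c₀' * c₁ + c₀' * c₀ = 1 := by
    linear_combination c₀' * hc + hc'
  calc (a * b) * (a' * b') = a * a' * (b * b') * (c₁' + c₀' * c₁ + c₀' * c₀) := by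
        rw [hsplit]; ring
    _ ≤ _ := by linarith

/-- Every triangle-local distribution satisfies the polynomial inequality
`I₃ = P_AC(0,0)·P_AC(1,1) + P_BC(0,1)·P_B(1) + P_BC(1,0)·P_BC(0,0)
      − P_AB(0,1)·P_AB(1,0) ≥ 0`. -/
theorem triangle_local_I3
    (P : Fin 2 → Fin 2 → Fin 2 → ℝ) (hP : IsTriangleLocal P) :
    (∑ b, P 0 b 0) * (∑ b, P 1 b 1)
      + (∑ a, P a 0 1) * (∑ a, ∑ c, P a 1 c)
      + (∑ a, P a 1 0) * (∑ a, P a 0 0)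
      - (∑ c, P 0 1 c) * (∑ c, P 1 0 c) ≥ 0 := by
  obtain ⟨nα, nβ, nγ, pα, pβ, pγ, PA, PB, PC, hα, -, hβ, -, hγ, -, hA, hA1, hB, hB1,
    hC, hC1, hP⟩ := hP
  simp only [Fin.sum_univ_two] at hA1 hB1 hC1
  have hA_le (a β γ) : PA a β γ ≤ 1 := by
    fin_cases a <;> simp <;> linarith [hA 0 β γ, hA 1 β γ, hA1 β γ]
  have hB_le (b γ α) : PB b γ α ≤ 1 := by
    fin_cases b <;> simp <;> linarith [hB 0 γ α, hB 1 γ α, hB1 γ α]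
  let w : Fin nα × Fin nβ × Fin nγ → ℝ := fun t => pα t.1 * pβ t.2.1 * pγ t.2.2
  have hP' (a b c) : P a b c =
      ∑ t, w t * PA a t.2.1 t.2.2 * PB b t.2.2 t.1 * PC c t.1 t.2.1 := by
    simp only [hP, Fintype.sum_prod_type, w]
  have hAC (a c) : ∑ b, P a b c = ∑ t, w t * (PA a t.2.1 t.2.2 * PC c t.1 t.2.1) := by
    simp only [Fin.sum_univ_two, hP', ← Finset.sum_add_distrib]
    refine Finset.sum_congr rfl fun t _ => ?_
    linear_combination w t * PA a t.2.1 t.2.2 * PC c t.1 t.2.1 * hB1 t.2.2 t.1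
  have hBC (b c) : ∑ a, P a b c = ∑ t, w t * (PB b t.2.2 t.1 * PC c t.1 t.2.1) := by
    simp only [Fin.sum_univ_two, hP', ← Finset.sum_add_distrib]
    refine Finset.sum_congr rfl fun t _ => ?_
    linear_combination w t * PB b t.2.2 t.1 * PC c t.1 t.2.1 * hA1 t.2.1 t.2.2
  have hAB (a b) : ∑ c, P a b c = ∑ t, w t * (PA a t.2.1 t.2.2 * PB b t.2.2 t.1) := by
    simp only [Fin.sum_univ_two, hP', ← Finset.sum_add_distrib]
    refine Finset.sum_congr rfl fun t _ => ?_
    linear_combination w t * PA a t.2.1 t.2.2 * PB b t.2.2 t.1 * hC1 t.1 t.2.1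
  have hB_marginal (b) : ∑ a, ∑ c, P a b c = ∑ t, w t * PB b t.2.2 t.1 := by
    simp only [hAB]
    rw [Fin.sum_univ_two, ← Finset.sum_add_distrib]
    refine Finset.sum_congr rfl fun t _ => ?_
    linear_combination w t * PB b t.2.2 t.1 * hA1 t.2.1 t.2.2
  rw [hB_marginal, hAC, hAC, hBC, hBC, hBC, hAB, hAB, ge_iff_le, sub_nonneg,
    mul_comm (∑ t, w t * (PB 0 t.2.2 t.1 * PC 1 t.1 t.2.1)),
    Finset.sum_mul_sum, ← Fintype.sum_prod_type', sum_mul_sum_swap_fst, sum_mul_sum_swap_snd,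
    sum_mul_sum_swap_snd, ← Finset.sum_add_distrib, ← Finset.sum_add_distrib]
  refine Finset.sum_le_sum fun ⟨⟨α, β, γ⟩, α', β', γ'⟩ _ => ?_
  have hw : 0 ≤ (pα α * pβ β * pγ γ) * (pα α' * pβ β' * pγ γ') :=
    mul_nonneg (mul_nonneg (mul_nonneg (hα _) (hβ _)) (hγ _))
      (mul_nonneg (mul_nonneg (hα _) (hβ _)) (hγ _))
  have key := mul_le_mul_of_nonneg_left (mul_le_of_split_outcomes
    (hA 0 β γ) (hA_le 0 β γ) (hA 1 β' γ') (hA_le 1 β' γ')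
    (hB 1 γ α) (hB_le 1 γ α) (hB 0 γ' α') (hB_le 0 γ' α')
    (hC 0 α β') (hC 1 α β') (hC1 α β') (hC 0 α' β) (hC 1 α' β) (hC1 α' β)) hw
  dsimp only [w]
  linarith
end

section
/- Every triangle-local probability distribution P on (Fin 2)³ satisfies the polynomial inequality I₄ = P_{AC}(0,0)·P_A(1) + P_{BC}(0,1)·P_B(1) − P_{AB}(0,1)·P_{AB}(1,0) ≥ 0. -/
/-- Every triangle-local distribution satisfies the polynomial inequality
`I₄ = P_AC(0,0)·P_A(1) + P_BC(0,1)·P_B(1) − P_AB(0,1)·P_AB(1,0) ≥ 0`. -/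
theorem triangle_local_I4
    (P : Fin 2 → Fin 2 → Fin 2 → ℝ) (hP : IsTriangleLocal P) :
    (∑ b, P 0 b 0) * (∑ b, ∑ c, P 1 b c)
      + (∑ a, P a 0 1) * (∑ a, ∑ c, P a 1 c)
      - (∑ c, P 0 1 c) * (∑ c, P 1 0 c) ≥ 0 := by
  obtain ⟨nα, nβ, nγ, pα, pβ, pγ, PA, PB, PC, hα, hα1, hβ, hβ1, hγ, hγ1,
    hA, hA1, hB, hB1, hC, hC1, hP⟩ := hP
  simp only [Fin.sum_univ_two] at hA1 hB1 hC1
  -- `u β` and `v α` condition the events `(a, b) = (0, 1)` and `(a, b) = (1, 0)` on one source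
  set u : Fin nβ → ℝ := fun β => ∑ γ, pγ γ * (PA 0 β γ * ∑ α, pα α * PB 1 γ α) with hu
  set v : Fin nα → ℝ := fun α => ∑ γ, pγ γ * (PB 0 γ α * ∑ β, pβ β * PA 1 β γ) with hv
  set a₀ : Fin nβ → ℝ := fun β => ∑ γ, pγ γ * PA 0 β γ with ha₀
  set b₀ : Fin nα → ℝ := fun α => ∑ γ, pγ γ * PB 0 γ α with hb₀
  set A₁ : ℝ := ∑ γ, pγ γ * ∑ β, pβ β * PA 1 β γ with hA₁
  set B₁ : ℝ := ∑ γ, pγ γ * ∑ α, pα α * PB 1 γ α with hB₁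
  have marginal_AC : ∑ b, P 0 b 0 = ∑ α, ∑ β, pα α * pβ β * (a₀ β * PC 0 α β) := by
    simp only [Fin.sum_univ_two, hP, ← Finset.sum_add_distrib, ha₀, Finset.sum_mul, Finset.mul_sum]
    refine Finset.sum_congr rfl fun α _ => Finset.sum_congr rfl fun β _ =>
      Finset.sum_congr rfl fun γ _ => ?_
    linear_combination (pα α * pβ β * pγ γ * PA 0 β γ * PC 0 α β) * hB1 γ α
  have marginal_BC : ∑ a, P a 0 1 = ∑ α, ∑ β, pα α * pβ β * (b₀ α * PC 1 α β) := by
    simp only [Fin.sum_univ_two, hP, ← Finset.sum_add_distrib, hb₀, Finset.sum_mul, Finset.mul_sum]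
    refine Finset.sum_congr rfl fun α _ => Finset.sum_congr rfl fun β _ =>
      Finset.sum_congr rfl fun γ _ => ?_
    linear_combination (pα α * pβ β * pγ γ * PB 0 γ α * PC 1 α β) * hA1 β γ
  have marginal_AB (a b : Fin 2) :
      ∑ c, P a b c = ∑ α, ∑ β, ∑ γ, pα α * pβ β * pγ γ * PA a β γ * PB b γ α := by
    simp only [Fin.sum_univ_two, hP, ← Finset.sum_add_distrib]
    refine Finset.sum_congr rfl fun α _ => Finset.sum_congr rfl fun β _ =>
      Finset.sum_congr rfl fun γ _ => ?_
    linear_combination (pα α * pβ β * pγ γ * PA a β γ * PB b γ α) * hC1 α β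
  have marginal_A : ∑ b, ∑ c, P 1 b c = A₁ := by
    calc ∑ b, ∑ c, P 1 b c = ∑ α, pα α * ∑ β, ∑ γ, pγ γ * (pβ β * PA 1 β γ) := by
          simp only [marginal_AB]
          simp only [Fin.sum_univ_two, ← Finset.sum_add_distrib, Finset.mul_sum]
          refine Finset.sum_congr rfl fun α _ => Finset.sum_congr rfl fun β _ =>
            Finset.sum_congr rfl fun γ _ => ?_
          linear_combination (pα α * pβ β * pγ γ * PA 1 β γ) * hB1 γ α
      _ = A₁ := by
          rw [← Finset.sum_mul, hα1, one_mul, Finset.sum_comm]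
          simp only [hA₁, Finset.mul_sum]
  have marginal_B : ∑ a, ∑ c, P a 1 c = B₁ := by
    calc ∑ a, ∑ c, P a 1 c = ∑ α, ∑ β, pβ β * ∑ γ, pγ γ * (pα α * PB 1 γ α) := by
          simp only [marginal_AB]
          simp only [Fin.sum_univ_two, ← Finset.sum_add_distrib, Finset.mul_sum]
          refine Finset.sum_congr rfl fun α _ => Finset.sum_congr rfl fun β _ =>
            Finset.sum_congr rfl fun γ _ => ?_
          linear_combination (pα α * pβ β * pγ γ * PB 1 γ α) * hA1 β γ
      _ = B₁ := by
          simp only [← Finset.sum_mul, hβ1, one_mul]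
          rw [Finset.sum_comm]
          simp only [hB₁, Finset.mul_sum]
  have marginal_AB_01 : ∑ c, P 0 1 c = ∑ β, pβ β * u β := by
    rw [marginal_AB, Finset.sum_comm]
    refine Finset.sum_congr rfl fun β _ => ?_
    rw [Finset.sum_comm]
    simp only [hu, Finset.mul_sum]
    refine Finset.sum_congr rfl fun γ _ => Finset.sum_congr rfl fun α _ => ?_
    ring
  have marginal_AB_10 : ∑ c, P 1 0 c = ∑ α, pα α * v α := by
    rw [marginal_AB]
    refine Finset.sum_congr rfl fun α _ => ?_
    rw [Finset.sum_comm]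
    simp only [hv, Finset.mul_sum]
    refine Finset.sum_congr rfl fun γ _ => Finset.sum_congr rfl fun β _ => ?_
    ring
  have hA_le (a β γ) : PA a β γ ≤ 1 := by
    have h := hA1 β γ
    fin_cases a <;> simp <;> linarith [hA 0 β γ, hA 1 β γ]
  have hB_le (b γ α) : PB b γ α ≤ 1 := by
    have h := hB1 γ α
    fin_cases b <;> simp <;> linarith [hB 0 γ α, hB 1 γ α]
  have avgA_nonneg (γ) : 0 ≤ ∑ β, pβ β * PA 1 β γ :=
    Finset.sum_nonneg fun β _ => mul_nonneg (hβ β) (hA 1 β γ)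
  have avgB_nonneg (γ) : 0 ≤ ∑ α, pα α * PB 1 γ α :=
    Finset.sum_nonneg fun α _ => mul_nonneg (hα α) (hB 1 γ α)
  have avgA_le (γ) : ∑ β, pβ β * PA 1 β γ ≤ 1 :=
    hβ1 ▸ Finset.sum_le_sum fun β _ => mul_le_of_le_one_right (hβ β) (hA_le 1 β γ)
  have avgB_le (γ) : ∑ α, pα α * PB 1 γ α ≤ 1 :=
    hα1 ▸ Finset.sum_le_sum fun α _ => mul_le_of_le_one_right (hα α) (hB_le 1 γ α)
  have u_nonneg (β) : 0 ≤ u β := Finset.sum_nonneg fun γ _ =>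
    mul_nonneg (hγ γ) (mul_nonneg (hA 0 β γ) (avgB_nonneg γ))
  have v_nonneg (α) : 0 ≤ v α := Finset.sum_nonneg fun γ _ =>
    mul_nonneg (hγ γ) (mul_nonneg (hB 0 γ α) (avgA_nonneg γ))
  have u_le_a₀ (β) : u β ≤ a₀ β := Finset.sum_le_sum fun γ _ =>
    mul_le_mul_of_nonneg_left (mul_le_of_le_one_right (hA 0 β γ) (avgB_le γ)) (hγ γ)
  have u_le_B₁ (β) : u β ≤ B₁ := Finset.sum_le_sum fun γ _ =>
    mul_le_mul_of_nonneg_left (mul_le_of_le_one_left (avgB_nonneg γ) (hA_le 0 β γ)) (hγ γ)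
  have v_le_b₀ (α) : v α ≤ b₀ α := Finset.sum_le_sum fun γ _ =>
    mul_le_mul_of_nonneg_left (mul_le_of_le_one_right (hB 0 γ α) (avgA_le γ)) (hγ γ)
  have v_le_A₁ (α) : v α ≤ A₁ := Finset.sum_le_sum fun γ _ =>
    mul_le_mul_of_nonneg_left (mul_le_of_le_one_left (avgA_nonneg γ) (hB_le 0 γ α)) (hγ γ)
  rw [marginal_AC, marginal_BC, marginal_A, marginal_B, marginal_AB_01, marginal_AB_10, ge_iff_le,
    sub_nonneg, mul_comm (∑ β, pβ β * u β), Finset.sum_mul_sum]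
  simp only [Finset.sum_mul, ← Finset.sum_add_distrib]
  refine Finset.sum_le_sum fun α _ => Finset.sum_le_sum fun β _ => ?_
  have h₀ : u β * v α * PC 0 α β ≤ a₀ β * A₁ * PC 0 α β :=
    mul_le_mul_of_nonneg_right (mul_le_mul (u_le_a₀ β) (v_le_A₁ α) (v_nonneg α)
      ((u_nonneg β).trans (u_le_a₀ β))) (hC 0 α β)
  have h₁ : u β * v α * PC 1 α β ≤ B₁ * b₀ α * PC 1 α β :=
    mul_le_mul_of_nonneg_right (mul_le_mul (u_le_B₁ β) (v_le_b₀ α) (v_nonneg α)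
      ((u_nonneg β).trans (u_le_B₁ β))) (hC 1 α β)
  calc pα α * v α * (pβ β * u β)
      = pα α * pβ β * (u β * v α * PC 0 α β + u β * v α * PC 1 α β) := by
        linear_combination -(pα α * v α * (pβ β * u β)) * hC1 α β
    _ ≤ pα α * pβ β * (a₀ β * A₁ * PC 0 α β + B₁ * b₀ α * PC 1 α β) :=
        mul_le_mul_of_nonneg_left (add_le_add h₀ h₁) (mul_nonneg (hα α) (hβ β))
    _ = _ := by ring
end

section
/- Every triangle-local probability distribution P on (Fin 2)³ satisfies the polynomial inequality I₅ = P(0,0,0) + P_{AB}(1,1)·P_C(1) + P_{AC}(1,1)·P_B(1) + P_{BC}(1,1)·P_A(1) − P_A(1)·P_B(1)·P_C(1) ≥ 0. -/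
/-- The expectation of `X` under the product of three weight functions. -/
def tripleMean {ι κ μ : Type*} [Fintype ι] [Fintype κ] [Fintype μ]
    (p : ι → ℝ) (q : κ → ℝ) (r : μ → ℝ) (X : ι → κ → μ → ℝ) : ℝ :=
  ∑ i, ∑ j, ∑ k, p i * q j * r k * X i j k

section tripleMean

variable {ι κ μ : Type*} [Fintype ι] [Fintype κ] [Fintype μ]
  {p : ι → ℝ} {q : κ → ℝ} {r : μ → ℝ}

lemma tripleMean_cycle (X : ι → κ → μ → ℝ) :
    tripleMean p q r X = tripleMean q r p (fun j k i => X i j k) := by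
  unfold tripleMean
  rw [Finset.sum_comm]
  refine Finset.sum_congr rfl fun j _ => ?_
  rw [Finset.sum_comm]
  exact Finset.sum_congr rfl fun k _ => Finset.sum_congr rfl fun i _ => by ring

lemma tripleMean_add (X Y : ι → κ → μ → ℝ) :
    tripleMean p q r (fun i j k => X i j k + Y i j k) =
      tripleMean p q r X + tripleMean p q r Y := by
  simp only [tripleMean, mul_add, Finset.sum_add_distrib]

lemma tripleMean_mono (hp : ∀ i, 0 ≤ p i) (hq : ∀ j, 0 ≤ q j) (hr : ∀ k, 0 ≤ r k)
    {X Y : ι → κ → μ → ℝ} (h : ∀ i j k, X i j k ≤ Y i j k) :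
    tripleMean p q r X ≤ tripleMean p q r Y :=
  Finset.sum_le_sum fun i _ => Finset.sum_le_sum fun j _ => Finset.sum_le_sum fun k _ =>
    mul_le_mul_of_nonneg_left (h i j k) (mul_nonneg (mul_nonneg (hp i) (hq j)) (hr k))

lemma tripleMean_mul (u : ι → ℝ) (v : κ → ℝ) (w : μ → ℝ) :
    tripleMean p q r (fun i j k => u i * v j * w k) =
      (∑ i, p i * u i) * (∑ j, q j * v j) * (∑ k, r k * w k) := by
  rw [Finset.sum_mul_sum, Finset.sum_mul]
  refine Finset.sum_congr rfl fun i _ => ?_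
  rw [Finset.sum_mul]
  refine Finset.sum_congr rfl fun j _ => ?_
  rw [Finset.mul_sum]
  exact Finset.sum_congr rfl fun k _ => by ring

/-- A variable depending only on the first two sources has the mean of its conditional mean. -/
lemma tripleMean_left (hr : ∑ k, r k = 1) (h : ι → κ → ℝ) :
    tripleMean p q r (fun i j _ => h i j) = ∑ i, p i * ∑ j, q j * h i j := by
  simp only [tripleMean, Finset.mul_sum]
  refine Finset.sum_congr rfl fun i _ => Finset.sum_congr rfl fun j _ => ?_
  rw [← Finset.sum_mul, ← Finset.mul_sum, hr]
  ring

/-- Averaging the dependence of `g` on the first source decouples it from `u`. -/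
lemma tripleMean_decouple (f : κ → μ → ℝ) (g : μ → ι → ℝ) (u : ι → ℝ) :
    tripleMean p q r (fun i j k => f j k * (∑ i', p i' * g k i') * u i) =
      tripleMean p q r (fun i j k => f j k * g k i) * ∑ i, p i * u i := by
  rw [tripleMean_cycle, tripleMean_cycle (fun i j k => f j k * g k i)]
  simp only [tripleMean, Finset.sum_mul]
  refine Finset.sum_congr rfl fun j _ => Finset.sum_congr rfl fun k _ => ?_
  simp only [Finset.mul_sum, Finset.sum_mul]
  rw [Finset.sum_comm]
  exact Finset.sum_congr rfl fun i' _ => Finset.sum_congr rfl fun i _ => by ring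

end tripleMean

lemma weighted_sum_mem_unit {κ : Type*} [Fintype κ] {q h : κ → ℝ} (hq : ∀ j, 0 ≤ q j)
    (hq1 : ∑ j, q j = 1) (h0 : ∀ j, 0 ≤ h j) (h1 : ∀ j, h j ≤ 1) :
    0 ≤ ∑ j, q j * h j ∧ ∑ j, q j * h j ≤ 1 :=
  ⟨Finset.sum_nonneg fun j _ => mul_nonneg (hq j) (h0 j),
    hq1 ▸ Finset.sum_le_sum fun j _ => mul_le_of_le_one_right (hq j) (h1 j)⟩

/-- The pointwise inequality on the spiral inflation of the triangle, where `x, y, z` are the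
outputs of the outer observers and `a, b, c` those of the inner ones. -/
lemma spiral_inequality {a b c x y z : ℝ} (ha : 0 ≤ a) (ha1 : a ≤ 1) (hb : 0 ≤ b) (hb1 : b ≤ 1)
    (hc : 0 ≤ c) (hc1 : c ≤ 1) (hx : 0 ≤ x) (hx1 : x ≤ 1) (hy : 0 ≤ y) (hy1 : y ≤ 1)
    (hz : 0 ≤ z) (hz1 : z ≤ 1) :
    z * x * y ≤ (1 - a) * (1 - b) * (1 - c) + a * y * z + b * z * x + c * x * y := by
  have hxy : 0 ≤ x * y := mul_nonneg hx hy
  have hxyz1 : x * y * z ≤ 1 := mul_le_one₀ (mul_le_one₀ hx1 hy hy1) hz hz1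
  have hprod : 0 ≤ (1 - a) * (1 - b) * (1 - c) :=
    mul_nonneg (mul_nonneg (sub_nonneg.2 ha1) (sub_nonneg.2 hb1)) (sub_nonneg.2 hc1)
  have hunion : 0 ≤ (1 - a) * (1 - b) * (1 - c) - 1 + a + b + c := by
    nlinarith [mul_nonneg (mul_nonneg ha hb) (sub_nonneg.2 hc1), mul_nonneg ha hc,
      mul_nonneg hb hc]
  have h1 := mul_nonneg (mul_nonneg hxy hz) hunion
  have h2 := mul_nonneg hprod (sub_nonneg.2 hxyz1)
  have h3 := mul_nonneg (mul_nonneg ha (mul_nonneg hy hz)) (sub_nonneg.2 hx1)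
  have h4 := mul_nonneg (mul_nonneg hb (mul_nonneg hz hx)) (sub_nonneg.2 hy1)
  have h5 := mul_nonneg (mul_nonneg hc hxy) (sub_nonneg.2 hz1)
  linarith

/-- Every triangle-local distribution satisfies the polynomial inequality
`I₅ = P(0,0,0) + P_AB(1,1)·P_C(1) + P_AC(1,1)·P_B(1) + P_BC(1,1)·P_A(1)
      − P_A(1)·P_B(1)·P_C(1) ≥ 0`. -/
theorem triangle_local_I5
    (P : Fin 2 → Fin 2 → Fin 2 → ℝ) (hP : IsTriangleLocal P) :
    P 0 0 0
      + (∑ c, P 1 1 c) * (∑ a, ∑ b, P a b 1)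
      + (∑ b, P 1 b 1) * (∑ a, ∑ c, P a 1 c)
      + (∑ a, P a 1 1) * (∑ b, ∑ c, P 1 b c)
      - (∑ b, ∑ c, P 1 b c) * (∑ a, ∑ c, P a 1 c) * (∑ a, ∑ b, P a b 1)
      ≥ 0 := by
  obtain ⟨nα, nβ, nγ, pα, pβ, pγ, PA, PB, PC, hα, hα1, hβ, hβ1, hγ, hγ1, hA, hA1, hB, hB1,
    hC, hC1, hP⟩ := hP
  simp only [Fin.sum_univ_two] at hA1 hB1 hC1
  have hA0 (β γ) : PA 0 β γ = 1 - PA 1 β γ := eq_sub_of_add_eq (hA1 β γ)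
  have hB0 (γ α) : PB 0 γ α = 1 - PB 1 γ α := eq_sub_of_add_eq (hB1 γ α)
  have hC0 (α β) : PC 0 α β = 1 - PC 1 α β := eq_sub_of_add_eq (hC1 α β)
  have hAle (β γ) : PA 1 β γ ≤ 1 := by linarith [hA 0 β γ, hA1 β γ]
  have hBle (γ α) : PB 1 γ α ≤ 1 := by linarith [hB 0 γ α, hB1 γ α]
  have hCle (α β) : PC 1 α β ≤ 1 := by linarith [hC 0 α β, hC1 α β]
  have hPE (a b c) : P a b c =
      tripleMean pα pβ pγ (fun α β γ => PA a β γ * PB b γ α * PC c α β) := by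
    simp only [hP, tripleMean, mul_assoc]
  have hAB : ∑ c, P 1 1 c = tripleMean pα pβ pγ (fun α β γ => PA 1 β γ * PB 1 γ α) := by
    simp only [Fin.sum_univ_two, hPE, ← tripleMean_add, hC0]
    congr 1
    funext α β γ
    ring
  have hAC : ∑ b, P 1 b 1 = tripleMean pα pβ pγ (fun α β γ => PC 1 α β * PA 1 β γ) := by
    simp only [Fin.sum_univ_two, hPE, ← tripleMean_add, hB0]
    congr 1
    funext α β γ
    ring
  have hBC : ∑ a, P a 1 1 = tripleMean pα pβ pγ (fun α β γ => PB 1 γ α * PC 1 α β) := by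
    simp only [Fin.sum_univ_two, hPE, ← tripleMean_add, hA0]
    congr 1
    funext α β γ
    ring
  have hsA : ∑ b, ∑ c, P 1 b c = ∑ β, pβ β * ∑ γ, pγ γ * PA 1 β γ := by
    rw [← tripleMean_left hα1, ← tripleMean_cycle (fun _ β γ => PA 1 β γ)]
    simp only [Fin.sum_univ_two, hPE, ← tripleMean_add, hB0, hC0]
    congr 1
    funext α β γ
    ring
  have hsB : ∑ a, ∑ c, P a 1 c = ∑ γ, pγ γ * ∑ α, pα α * PB 1 γ α := by
    rw [← tripleMean_left hβ1, tripleMean_cycle]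
    simp only [Fin.sum_univ_two, hPE, ← tripleMean_add, hA0, hC0]
    congr 1
    funext α β γ
    ring
  have hsC : ∑ a, ∑ b, P a b 1 = ∑ α, pα α * ∑ β, pβ β * PC 1 α β := by
    rw [← tripleMean_left hγ1]
    simp only [Fin.sum_univ_two, hPE, ← tripleMean_add, hA0, hB0]
    congr 1
    funext α β γ
    ring
  have hFA (β) := weighted_sum_mem_unit hγ hγ1 (hA 1 β) (hAle β)
  have hFB (γ) := weighted_sum_mem_unit hα hα1 (hB 1 γ) (hBle γ)
  have hFC (α) := weighted_sum_mem_unit hβ hβ1 (hC 1 α) (hCle α)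
  have key := tripleMean_mono hα hβ hγ fun α β γ =>
    spiral_inequality (hA 1 β γ) (hAle β γ) (hB 1 γ α) (hBle γ α) (hC 1 α β) (hCle α β)
      (hFA β).1 (hFA β).2 (hFB γ).1 (hFB γ).2 (hFC α).1 (hFC α).2
  simp only [tripleMean_add] at key
  rw [tripleMean_mul, tripleMean_decouple (fun β γ => PA 1 β γ) (fun γ α => PB 1 γ α),
    tripleMean_cycle (fun α β γ => PB 1 γ α * _ * _),
    tripleMean_decouple (fun γ α => PB 1 γ α) (fun α β => PC 1 α β),
    ← tripleMean_cycle (fun α _ γ => PB 1 γ α * PC 1 α _),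
    ← tripleMean_cycle (fun γ α β => PC 1 α β * _ * _),
    tripleMean_decouple (fun α β => PC 1 α β) (fun β γ => PA 1 β γ),
    tripleMean_cycle (fun γ α β => PC 1 α β * PA 1 β γ)] at key
  have h000 : P 0 0 0 = tripleMean pα pβ pγ
      (fun α β γ => (1 - PA 1 β γ) * (1 - PB 1 γ α) * (1 - PC 1 α β)) := by
    simp only [hPE, hA0, hB0, hC0]
  rw [h000, hAB, hAC, hBC, hsA, hsB, hsC]
  linarith
end

section
/- Let ε₁ be a real number with 0 < ε₁ ≤ 1. Consider any ε₁-relaxed triangle-local probability distribution P on (Fin 2)³, where moreover every value of the marginal source distributions p_α, p_β, p_γ is strictly positive. Then there exists a triangle-local probability distribution Q on (Fin 2)³ (with fully independent sources) whose support equals the support of P. (Hence, at the possibilistic level, the ε₁-relaxed local set of patterns coincides with the local set of patterns for every ε₁ > 0.) -/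
/-- A triple sum of nonnegative terms weighted by a strictly positive function is positive
exactly when one of the terms is. -/
lemma sum_sum_sum_weight_pos_iff {ι κ τ : Type*} [Fintype ι] [Fintype κ] [Fintype τ]
    {w f : ι → κ → τ → ℝ} (hw : ∀ i j k, 0 < w i j k) (hf : ∀ i j k, 0 ≤ f i j k) :
    (0 < ∑ i, ∑ j, ∑ k, w i j k * f i j k) ↔ ∃ i j k, 0 < f i j k := by
  have h (i j k) : 0 ≤ w i j k * f i j k := mul_nonneg (hw i j k).le (hf i j k)
  rw [Finset.sum_pos_iff_of_nonneg fun i _ =>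
    Finset.sum_nonneg fun j _ => Finset.sum_nonneg fun k _ => h i j k]
  simp only [Finset.mem_univ, true_and]
  refine exists_congr fun i => ?_
  rw [Finset.sum_pos_iff_of_nonneg fun j _ => Finset.sum_nonneg fun k _ => h i j k]
  simp only [Finset.mem_univ, true_and]
  refine exists_congr fun j => ?_
  rw [Finset.sum_pos_iff_of_nonneg fun k _ => h i j k]
  simp [mul_pos_iff_of_pos_left, hw]

/-- A mixture of families of total mass one has total mass one. -/
lemma sum_mixture_eq_one {ι κ : Type*} [Fintype ι] [Fintype κ] {w : κ → ℝ} {q : ι → κ → ℝ}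
    (hw : ∑ l, w l = 1) (hq : ∀ l, ∑ i, q i l = 1) : ∑ i, ∑ l, w l * q i l = 1 := by
  rw [Finset.sum_comm]
  simp [← Finset.mul_sum, hq, hw]

/-- For any `0 < ε₁ ≤ 1`, an `ε₁`-relaxed triangle-local distribution
(with strictly positive marginal source distributions) has the same support
as some genuinely triangle-local distribution: at the possibilistic level,
`𝖫_{ε₁} = 𝖫`. -/
theorem relaxed_local_same_patterns
    (ε₁ : ℝ) (hε0 : 0 < ε₁) (hε1 : ε₁ ≤ 1)
    (nα nβ nγ nΛ : ℕ)
    (PΛ : Fin nΛ → ℝ)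
    (p : Fin nα → Fin nβ → Fin nγ → Fin nΛ → ℝ)
    (PA : Fin 2 → Fin nβ → Fin nγ → ℝ)
    (PB : Fin 2 → Fin nγ → Fin nα → ℝ)
    (PC : Fin 2 → Fin nα → Fin nβ → ℝ)
    (hΛpos : ∀ l, 0 < PΛ l) (hΛsum : (∑ l, PΛ l) = 1)
    (hp0 : ∀ α β γ l, 0 ≤ p α β γ l)
    (hpsum : ∀ l, (∑ α, ∑ β, ∑ γ, p α β γ l) = 1)
    (hPA0 : ∀ a β γ, 0 ≤ PA a β γ) (hPA1 : ∀ β γ, (∑ a, PA a β γ) = 1)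
    (hPB0 : ∀ b γ α, 0 ≤ PB b γ α) (hPB1 : ∀ γ α, (∑ b, PB b γ α) = 1)
    (hPC0 : ∀ c α β, 0 ≤ PC c α β) (hPC1 : ∀ α β, (∑ c, PC c α β) = 1)
    -- lower bound: ε₁·pα(α)·pβ(β)·pγ(γ) ≤ p(α,β,γ|λ)
    (hlow : ∀ α β γ l,
      ε₁ * (∑ l', PΛ l' * ∑ β', ∑ γ', p α β' γ' l')
         * (∑ l', PΛ l' * ∑ α', ∑ γ', p α' β γ' l')
         * (∑ l', PΛ l' * ∑ α', ∑ β', p α' β' γ l') ≤ p α β γ l)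
    -- the marginal source distributions are strictly positive
    (hαpos : ∀ α, 0 < ∑ l', PΛ l' * ∑ β', ∑ γ', p α β' γ' l')
    (hβpos : ∀ β, 0 < ∑ l', PΛ l' * ∑ α', ∑ γ', p α' β γ' l')
    (hγpos : ∀ γ, 0 < ∑ l', PΛ l' * ∑ α', ∑ β', p α' β' γ l')
    (P : Fin 2 → Fin 2 → Fin 2 → ℝ)
    (hP : ∀ a b c, P a b c =
      ∑ l, PΛ l * ∑ α, ∑ β, ∑ γ,
        p α β γ l * PA a β γ * PB b γ α * PC c α β) :
    ∃ Q : Fin 2 → Fin 2 → Fin 2 → ℝ, IsTriangleLocal Q ∧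
      ∀ a b c, (0 < Q a b c ↔ 0 < P a b c) := by
  have hp (α β γ l) : 0 < p α β γ l :=
    lt_of_lt_of_le (mul_pos (mul_pos (mul_pos hε0 (hαpos α)) (hβpos β)) (hγpos γ))
      (hlow α β γ l)
  have hΛ : (Finset.univ : Finset (Fin nΛ)).Nonempty :=
    Finset.nonempty_of_sum_ne_zero (hΛsum.trans_ne one_ne_zero)
  refine ⟨_, ⟨nα, nβ, nγ, _, _, _, PA, PB, PC,
    fun α => (hαpos α).le, sum_mixture_eq_one hΛsum hpsum,
    fun β => (hβpos β).le, sum_mixture_eq_one hΛsum fun l => ?_,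
    fun γ => (hγpos γ).le, sum_mixture_eq_one hΛsum fun l => ?_,
    hPA0, hPA1, hPB0, hPB1, hPC0, hPC1, fun _ _ _ => rfl⟩, fun a b c => ?_⟩
  · rw [Finset.sum_comm, hpsum]
  · rw [Finset.sum_comm, ← hpsum l]
    refine Finset.sum_congr rfl fun α _ => ?_
    rw [Finset.sum_comm]
  · have hf (α β γ) : 0 ≤ PA a β γ * PB b γ α * PC c α β :=
      mul_nonneg (mul_nonneg (hPA0 a β γ) (hPB0 b γ α)) (hPC0 c α β)
    have hPiff (l) : 0 < PΛ l * ∑ α, ∑ β, ∑ γ, p α β γ l * (PA a β γ * PB b γ α * PC c α β) ↔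
        ∃ α β γ, 0 < PA a β γ * PB b γ α * PC c α β := by
      rw [mul_pos_iff_of_pos_left (hΛpos l),
        sum_sum_sum_weight_pos_iff (fun α β γ => hp α β γ l) hf]
    have hQiff := sum_sum_sum_weight_pos_iff
      (fun α β γ => mul_pos (mul_pos (hαpos α) (hβpos β)) (hγpos γ)) hf
    simp only [← mul_assoc] at hPiff hQiff
    rw [hP, hQiff, Finset.sum_pos_iff_of_nonneg]
    · obtain ⟨l, hl⟩ := hΛ
      exact ⟨fun h => ⟨l, hl, (hPiff l).2 h⟩, fun ⟨l, _, h⟩ => (hPiff l).1 h⟩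
    · intro l _
      refine mul_nonneg (hΛpos l).le (Finset.sum_nonneg fun α _ => Finset.sum_nonneg fun β _ =>
        Finset.sum_nonneg fun γ _ => ?_)
      simpa only [← mul_assoc] using mul_nonneg (hp0 α β γ l) (hf α β γ)
end

section
/- Let 0 < ε₁ ≤ 1 ≤ ε₂. Let P be an (ε₁,ε₂)-relaxed triangle-local probability distribution on (Fin 2)³, i.e. a relaxed triangle-local distribution in which the conditional joint source distribution satisfies both the lower bound ε₁·p_α(α)·p_β(β)·p_γ(γ) ≤ p(α,β,γ | λ) and the upper bound p(α,β,γ | λ) ≤ ε₂·p_α(α)·p_β(β)·p_γ(γ) for all α,β,γ,λ. Then the observed distribution satisfies the robust cut inequality ε₁² · P_A(0)·P_C(1) ≤ ε₂ · (P_{AB}(0,1) + P_{BC}(0,1)). -/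
section TriangleCut

variable {X Y Z : Type*} [Fintype X] [Fintype Y] [Fintype Z]

/-- The robust cut inequality for a single approximately independent source distribution `q`,
in terms of the event weights `A` (for `a = 0`), `B₀`, `B₁` and `C` (for `c = 1`). -/
theorem cut_inequality_of_approx_independent {ε₁ ε₂ : ℝ} (hε₁ : 0 ≤ ε₁) (hε₂ : 0 ≤ ε₂)
    {q : X → Y → Z → ℝ} (hq : ∀ x y z, 0 ≤ q x y z)
    {pX : X → ℝ} {pY : Y → ℝ} {pZ : Z → ℝ}
    (hX : ∀ x, ∑ y, ∑ z, q x y z = pX x) (hZ : ∀ z, ∑ x, ∑ y, q x y z = pZ z)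
    (hX1 : ∑ x, pX x = 1) (hZ1 : ∑ z, pZ z = 1)
    (hlow : ∀ x y z, ε₁ * pX x * pY y * pZ z ≤ q x y z)
    (hupp : ∀ x y z, q x y z ≤ ε₂ * pX x * pY y * pZ z)
    {A : Y → Z → ℝ} {B₀ B₁ : Z → X → ℝ} {C : X → Y → ℝ}
    (hA0 : ∀ y z, 0 ≤ A y z) (hA1 : ∀ y z, A y z ≤ 1)
    (hB₀ : ∀ z x, 0 ≤ B₀ z x) (hB₁ : ∀ z x, 0 ≤ B₁ z x) (hB : ∀ z x, B₀ z x + B₁ z x = 1)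
    (hC0 : ∀ x y, 0 ≤ C x y) (hC1 : ∀ x y, C x y ≤ 1) :
    ε₁ * ((∑ x, ∑ y, ∑ z, q x y z * A y z) * (∑ x, ∑ y, ∑ z, q x y z * C x y)) ≤
      ε₂ * ((∑ x, ∑ y, ∑ z, q x y z * A y z * B₁ z x) +
        ∑ x, ∑ y, ∑ z, q x y z * B₀ z x * C x y) := by
  have hpX : ∀ x, 0 ≤ pX x := fun x => by
    rw [← hX]; exact Finset.sum_nonneg fun y _ => Finset.sum_nonneg fun z _ => hq x y z
  have hpZ : ∀ z, 0 ≤ pZ z := fun z => by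
    rw [← hZ]; exact Finset.sum_nonneg fun x _ => Finset.sum_nonneg fun y _ => hq x y z
  set u : Z → ℝ := fun z => ∑ x, ∑ y, q x y z * A y z with hu
  set v : X → ℝ := fun x => ∑ y, ∑ z, q x y z * C x y
  set F : Z → ℝ := fun z => ∑ y, pY y * A y z with hF
  set G : X → ℝ := fun x => ∑ y, pY y * C x y with hG
  have hu0 : ∀ z, 0 ≤ u z := fun z =>
    Finset.sum_nonneg fun x _ => Finset.sum_nonneg fun y _ => mul_nonneg (hq x y z) (hA0 y z)
  have hv0 : ∀ x, 0 ≤ v x := fun x =>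
    Finset.sum_nonneg fun y _ => Finset.sum_nonneg fun z _ => mul_nonneg (hq x y z) (hC0 x y)
  have hu_le : ∀ z, u z ≤ pZ z := fun z => by
    rw [← hZ]
    exact Finset.sum_le_sum fun x _ => Finset.sum_le_sum fun y _ =>
      mul_le_of_le_one_right (hq x y z) (hA1 y z)
  have hv_le : ∀ x, v x ≤ pX x := fun x => by
    rw [← hX]
    exact Finset.sum_le_sum fun y _ => Finset.sum_le_sum fun z _ =>
      mul_le_of_le_one_right (hq x y z) (hC1 x y)
  have hu_upp : ∀ z, u z ≤ ε₂ * pZ z * F z := fun z => by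
    calc u z ≤ ∑ x, ∑ y, ε₂ * pX x * pY y * pZ z * A y z :=
          Finset.sum_le_sum fun x _ => Finset.sum_le_sum fun y _ =>
            mul_le_mul_of_nonneg_right (hupp x y z) (hA0 y z)
      _ = ∑ x, pX x * (ε₂ * pZ z * F z) := by
          refine Finset.sum_congr rfl fun x _ => ?_
          simp only [hF, Finset.mul_sum]
          exact Finset.sum_congr rfl fun y _ => by ring
      _ = ε₂ * pZ z * F z := by rw [← Finset.sum_mul, hX1, one_mul]
  have hv_upp : ∀ x, v x ≤ ε₂ * pX x * G x := fun x => by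
    calc v x ≤ ∑ y, ∑ z, ε₂ * pX x * pY y * pZ z * C x y :=
          Finset.sum_le_sum fun y _ => Finset.sum_le_sum fun z _ =>
            mul_le_mul_of_nonneg_right (hupp x y z) (hC0 x y)
      _ = ∑ z, pZ z * (ε₂ * pX x * G x) := by
          rw [Finset.sum_comm]
          refine Finset.sum_congr rfl fun z _ => ?_
          simp only [hG, Finset.mul_sum]
          exact Finset.sum_congr rfl fun y _ => by ring
      _ = ε₂ * pX x * G x := by rw [← Finset.sum_mul, hZ1, one_mul]
  have hf : ∀ x z, ε₁ * (pX x * pZ z * F z) ≤ ∑ y, q x y z * A y z := fun x z => by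
    simp only [hF, Finset.mul_sum]
    refine Finset.sum_le_sum fun y _ => ?_
    have h := mul_le_mul_of_nonneg_right (hlow x y z) (hA0 y z)
    linarith
  have hg : ∀ x z, ε₁ * (pX x * pZ z * G x) ≤ ∑ y, q x y z * C x y := fun x z => by
    simp only [hG, Finset.mul_sum]
    refine Finset.sum_le_sum fun y _ => ?_
    have h := mul_le_mul_of_nonneg_right (hlow x y z) (hC0 x y)
    linarith
  have huvF : ∀ x z, ε₁ * (u z * v x) ≤ ε₂ * ∑ y, q x y z * A y z := fun x z => by
    have h₁ : u z * v x ≤ ε₂ * pZ z * F z * pX x :=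
      mul_le_mul (hu_upp z) (hv_le x) (hv0 x) ((hu0 z).trans (hu_upp z))
    have h₂ := mul_le_mul_of_nonneg_left h₁ hε₁
    have h₃ := mul_le_mul_of_nonneg_left (hf x z) hε₂
    linarith
  have huvG : ∀ x z, ε₁ * (u z * v x) ≤ ε₂ * ∑ y, q x y z * C x y := fun x z => by
    have h₁ : u z * v x ≤ pZ z * (ε₂ * pX x * G x) :=
      mul_le_mul (hu_le z) (hv_upp x) (hv0 x) (hpZ z)
    have h₂ := mul_le_mul_of_nonneg_left h₁ hε₁
    have h₃ := mul_le_mul_of_nonneg_left (hg x z) hε₂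
    linarith
  have hA_sum : ∑ x, ∑ y, ∑ z, q x y z * A y z = ∑ z, u z := by
    rw [hu, Finset.sum_comm (s := (Finset.univ : Finset Z))]
    exact Finset.sum_congr rfl fun x _ => Finset.sum_comm
  calc ε₁ * ((∑ x, ∑ y, ∑ z, q x y z * A y z) * ∑ x, v x)
      = ∑ x, ∑ z, ε₁ * (u z * v x) := by
        rw [hA_sum, Finset.sum_mul_sum, Finset.sum_comm]
        simp only [Finset.mul_sum]
    _ ≤ ∑ x, ∑ z, ε₂ * ((∑ y, q x y z * A y z) * B₁ z x +
          (∑ y, q x y z * C x y) * B₀ z x) := by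
        refine Finset.sum_le_sum fun x _ => Finset.sum_le_sum fun z _ => ?_
        have h₁ := mul_le_mul_of_nonneg_right (huvF x z) (hB₁ z x)
        have h₀ := mul_le_mul_of_nonneg_right (huvG x z) (hB₀ z x)
        have h : ε₁ * (u z * v x) =
            ε₁ * (u z * v x) * B₀ z x + ε₁ * (u z * v x) * B₁ z x := by
          rw [← mul_add, hB, mul_one]
        linarith
    _ = _ := by
        simp only [← Finset.mul_sum, Finset.sum_add_distrib, Finset.sum_mul]
        congr 2
        · exact Finset.sum_congr rfl fun x _ => Finset.sum_comm
        · refine Finset.sum_congr rfl fun x _ => ?_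
          rw [Finset.sum_comm]
          exact Finset.sum_congr rfl fun y _ => Finset.sum_congr rfl fun z _ => by ring

/-- A mixture of triple sums is the triple sum of the mixture. -/
theorem sum_mul_sum_triple {L : Type*} [Fintype L] (w : L → ℝ) (p : X → Y → Z → L → ℝ)
    (f : X → Y → Z → ℝ) :
    ∑ l, w l * ∑ x, ∑ y, ∑ z, p x y z l * f x y z =
      ∑ x, ∑ y, ∑ z, (∑ l, w l * p x y z l) * f x y z := by
  simp only [Finset.mul_sum, Finset.sum_mul]
  rw [Finset.sum_comm]
  refine Finset.sum_congr rfl fun x _ => ?_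
  rw [Finset.sum_comm]
  refine Finset.sum_congr rfl fun y _ => ?_
  rw [Finset.sum_comm]
  exact Finset.sum_congr rfl fun z _ => Finset.sum_congr rfl fun l _ => by ring

/-- A mixture of double sums is the double sum of the mixture. -/
theorem sum_mul_sum_double {L : Type*} [Fintype L] (w : L → ℝ) (p : X → Y → L → ℝ) :
    ∑ l, w l * ∑ x, ∑ y, p x y l = ∑ x, ∑ y, ∑ l, w l * p x y l := by
  simp only [Finset.mul_sum]
  rw [Finset.sum_comm]
  exact Finset.sum_congr rfl fun x _ => Finset.sum_comm

end TriangleCut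

/-- An `(ε₁,ε₂)`-relaxed triangle-local distribution satisfies the robust cut
inequality `ε₁² · P_A(0)·P_C(1) ≤ ε₂ · (P_AB(0,1) + P_BC(0,1))`. -/
theorem relaxed_local_robust_cut_inequality
    (ε₁ ε₂ : ℝ) (hε0 : 0 < ε₁) (hε1 : ε₁ ≤ 1) (hε2 : 1 ≤ ε₂)
    (nα nβ nγ nΛ : ℕ)
    (PΛ : Fin nΛ → ℝ)
    (p : Fin nα → Fin nβ → Fin nγ → Fin nΛ → ℝ)
    (PA : Fin 2 → Fin nβ → Fin nγ → ℝ)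
    (PB : Fin 2 → Fin nγ → Fin nα → ℝ)
    (PC : Fin 2 → Fin nα → Fin nβ → ℝ)
    (hΛpos : ∀ l, 0 < PΛ l) (hΛsum : (∑ l, PΛ l) = 1)
    (hp0 : ∀ α β γ l, 0 ≤ p α β γ l)
    (hpsum : ∀ l, (∑ α, ∑ β, ∑ γ, p α β γ l) = 1)
    (hPA0 : ∀ a β γ, 0 ≤ PA a β γ) (hPA1 : ∀ β γ, (∑ a, PA a β γ) = 1)
    (hPB0 : ∀ b γ α, 0 ≤ PB b γ α) (hPB1 : ∀ γ α, (∑ b, PB b γ α) = 1)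
    (hPC0 : ∀ c α β, 0 ≤ PC c α β) (hPC1 : ∀ α β, (∑ c, PC c α β) = 1)
    -- lower bound: ε₁·pα(α)·pβ(β)·pγ(γ) ≤ p(α,β,γ|λ)
    (hlow : ∀ α β γ l,
      ε₁ * (∑ l', PΛ l' * ∑ β', ∑ γ', p α β' γ' l')
         * (∑ l', PΛ l' * ∑ α', ∑ γ', p α' β γ' l')
         * (∑ l', PΛ l' * ∑ α', ∑ β', p α' β' γ l') ≤ p α β γ l)
    -- upper bound: p(α,β,γ|λ) ≤ ε₂·pα(α)·pβ(β)·pγ(γ)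
    (hupp : ∀ α β γ l,
      p α β γ l ≤
      ε₂ * (∑ l', PΛ l' * ∑ β', ∑ γ', p α β' γ' l')
         * (∑ l', PΛ l' * ∑ α', ∑ γ', p α' β γ' l')
         * (∑ l', PΛ l' * ∑ α', ∑ β', p α' β' γ l'))
    (P : Fin 2 → Fin 2 → Fin 2 → ℝ)
    (hP : ∀ a b c, P a b c =
      ∑ l, PΛ l * ∑ α, ∑ β, ∑ γ,
        p α β γ l * PA a β γ * PB b γ α * PC c α β) :
    ε₁ ^ 2 * ((∑ b, ∑ c, P 0 b c) * (∑ a, ∑ b, P a b 1)) ≤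
      ε₂ * ((∑ c, P 0 1 c) + (∑ a, P a 0 1)) := by
  set q : Fin nα → Fin nβ → Fin nγ → ℝ := fun α β γ => ∑ l, PΛ l * p α β γ l
  have hq : ∀ α β γ, 0 ≤ q α β γ := fun α β γ =>
    Finset.sum_nonneg fun l _ => mul_nonneg (hΛpos l).le (hp0 α β γ l)
  have hPq : ∀ a b c, P a b c =
      ∑ α, ∑ β, ∑ γ, q α β γ * (PA a β γ * PB b γ α * PC c α β) := fun a b c => by
    rw [hP, ← sum_mul_sum_triple]
    simp only [mul_assoc]
  have hq1 : ∑ α, ∑ β, ∑ γ, q α β γ = 1 := by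
    have h := sum_mul_sum_triple PΛ p fun _ _ _ => 1
    simp only [mul_one, hpsum, hΛsum] at h
    exact h.symm
  have hconst : ∀ t : ℝ, ∑ l, PΛ l * t = t := fun t => by
    rw [← Finset.sum_mul, hΛsum, one_mul]
  set pα : Fin nα → ℝ := fun α => ∑ l', PΛ l' * ∑ β', ∑ γ', p α β' γ' l'
  set pβ : Fin nβ → ℝ := fun β => ∑ l', PΛ l' * ∑ α', ∑ γ', p α' β γ' l'
  set pγ : Fin nγ → ℝ := fun γ => ∑ l', PΛ l' * ∑ α', ∑ β', p α' β' γ l'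
  have hα : ∀ α, ∑ β, ∑ γ, q α β γ = pα α := fun α =>
    (sum_mul_sum_double PΛ fun β γ l => p α β γ l).symm
  have hγ : ∀ γ, ∑ α, ∑ β, q α β γ = pγ γ := fun γ =>
    (sum_mul_sum_double PΛ fun α β l => p α β γ l).symm
  have hα1 : ∑ α, pα α = 1 := by simp only [← hα, hq1]
  have hγ1 : ∑ γ, pγ γ = 1 := by
    simp only [← hγ]
    rw [Finset.sum_comm, ← hq1]
    exact Finset.sum_congr rfl fun α _ => Finset.sum_comm
  have hlow' : ∀ α β γ, ε₁ * pα α * pβ β * pγ γ ≤ q α β γ := fun α β γ => by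
    rw [← hconst (ε₁ * pα α * pβ β * pγ γ)]
    exact Finset.sum_le_sum fun l _ => mul_le_mul_of_nonneg_left (hlow α β γ l) (hΛpos l).le
  have hupp' : ∀ α β γ, q α β γ ≤ ε₂ * pα α * pβ β * pγ γ := fun α β γ => by
    rw [← hconst (ε₂ * pα α * pβ β * pγ γ)]
    exact Finset.sum_le_sum fun l _ => mul_le_mul_of_nonneg_left (hupp α β γ l) (hΛpos l).le
  simp only [Fin.sum_univ_two] at hPA1 hPB1 hPC1
  have hcut := cut_inequality_of_approx_independent hε0.le (by linarith : (0 : ℝ) ≤ ε₂) hq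
    hα hγ hα1 hγ1 hlow' hupp' (hPA0 0)
    (fun β γ => by linarith [hPA1 β γ, hPA0 1 β γ]) (hPB0 0) (hPB0 1) hPB1 (hPC0 1)
    (fun α β => by linarith [hPC1 α β, hPC0 0 α β])
  have hPA : ∑ b, ∑ c, P 0 b c = ∑ α, ∑ β, ∑ γ, q α β γ * PA 0 β γ := by
    simp only [hPq, Fin.sum_univ_two, ← Finset.sum_add_distrib]
    refine Finset.sum_congr rfl fun α _ => Finset.sum_congr rfl fun β _ =>
      Finset.sum_congr rfl fun γ _ => ?_
    linear_combination q α β γ * PA 0 β γ * ((PB 0 γ α + PB 1 γ α) * hPC1 α β + hPB1 γ α)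
  have hPC : ∑ a, ∑ b, P a b 1 = ∑ α, ∑ β, ∑ γ, q α β γ * PC 1 α β := by
    simp only [hPq, Fin.sum_univ_two, ← Finset.sum_add_distrib]
    refine Finset.sum_congr rfl fun α _ => Finset.sum_congr rfl fun β _ =>
      Finset.sum_congr rfl fun γ _ => ?_
    linear_combination q α β γ * PC 1 α β * ((PB 0 γ α + PB 1 γ α) * hPA1 β γ + hPB1 γ α)
  have hPAB : ∑ c, P 0 1 c = ∑ α, ∑ β, ∑ γ, q α β γ * PA 0 β γ * PB 1 γ α := by
    simp only [hPq, Fin.sum_univ_two, ← Finset.sum_add_distrib]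
    refine Finset.sum_congr rfl fun α _ => Finset.sum_congr rfl fun β _ =>
      Finset.sum_congr rfl fun γ _ => ?_
    linear_combination q α β γ * PA 0 β γ * PB 1 γ α * hPC1 α β
  have hPBC : ∑ a, P a 0 1 = ∑ α, ∑ β, ∑ γ, q α β γ * PB 0 γ α * PC 1 α β := by
    simp only [hPq, Fin.sum_univ_two, ← Finset.sum_add_distrib]
    refine Finset.sum_congr rfl fun α _ => Finset.sum_congr rfl fun β _ =>
      Finset.sum_congr rfl fun γ _ => ?_
    linear_combination q α β γ * PB 0 γ α * PC 1 α β * hPA1 β γ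
  rw [hPA, hPC, hPAB, hPBC]
  refine le_trans (mul_le_mul_of_nonneg_right ?_ (mul_nonneg ?_ ?_)) hcut
  · nlinarith
  · exact Finset.sum_nonneg fun α _ => Finset.sum_nonneg fun β _ => Finset.sum_nonneg fun γ _ =>
      mul_nonneg (hq α β γ) (hPA0 0 β γ)
  · exact Finset.sum_nonneg fun α _ => Finset.sum_nonneg fun β _ => Finset.sum_nonneg fun γ _ =>
      mul_nonneg (hq α β γ) (hPC0 1 α β)
end

section
/- Consider the action of the relabeling group G of the triangle scenario — the group generated by all permutations of the three coordinates (the symmetric group S₃ on observers) and all independent flips of each binary outcome (the group (S₂)³) — on the set of patterns, i.e. Boolean-valued functions (Fin 2)³ → Bool, acting by 𝖯 ↦ (a,b,c) ↦ 𝖯(π₁(a_{σ⁻¹(1)}), π₂(a_{σ⁻¹(2)}), π₃(a_{σ⁻¹(3)})). Then the set of the 255 patterns that are not identically false decomposes into exactly 21 orbits under this action. -/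
/-- Two triangle patterns are related by a relabeling: a permutation of the
three observers together with an independent relabeling of each observer's
binary outcome. -/
def triRel (P Q : (Fin 3 → Fin 2) → Bool) : Prop :=
  ∃ (σ : Equiv.Perm (Fin 3)) (π : Fin 3 → Equiv.Perm (Fin 2)),
    ∀ v : Fin 3 → Fin 2, Q v = P fun i => π i (v (σ i))

/-- The orbit of a triangle pattern under the relabeling group. -/
def triOrbit (P : (Fin 3 → Fin 2) → Bool) : Set ((Fin 3 → Fin 2) → Bool) :=
  {Q | triRel P Q}

theorem triRel_equivalence : Equivalence triRel where
  refl P := ⟨1, 1, fun _ => rfl⟩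
  symm := by
    rintro P Q ⟨σ, π, h⟩
    refine ⟨σ⁻¹, fun i => (π (σ⁻¹ i))⁻¹, fun v => ?_⟩
    simp [h]
  trans := by
    rintro P Q R ⟨σ, π, h⟩ ⟨τ, ρ, k⟩
    refine ⟨σ.trans τ, fun i => (ρ (σ i)).trans (π i), fun v => ?_⟩
    simp [h, k]

theorem triOrbit_eq_iff {P Q : (Fin 3 → Fin 2) → Bool} :
    triOrbit P = triOrbit Q ↔ triRel P Q := by
  refine ⟨fun h => ?_, fun h => ?_⟩
  · have hQ : Q ∈ triOrbit Q := triRel_equivalence.refl Q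
    rwa [← h] at hQ
  · ext R
    exact ⟨triRel_equivalence.trans (triRel_equivalence.symm h), triRel_equivalence.trans h⟩

theorem triRel_iff_exists_add {P Q : (Fin 3 → Fin 2) → Bool} :
    triRel P Q ↔ ∃ (σ : Fin 3 → Fin 3) (f : Fin 3 → Fin 2), σ.Injective ∧
      ∀ v, Q v = P fun i => v (σ i) + f i := by
  constructor
  · rintro ⟨σ, π, h⟩
    have hadd : ∀ (ρ : Equiv.Perm (Fin 2)) (x : Fin 2), ρ x = x + ρ 0 := by decide
    refine ⟨σ, fun i => π i 0, σ.injective, fun v => ?_⟩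
    simp only [h, fun i => hadd (π i) (v (σ i))]
  · rintro ⟨σ, f, hσ, h⟩
    exact ⟨Equiv.ofBijective σ (Finite.injective_iff_bijective.1 hσ),
      fun i => Equiv.addRight (f i), h⟩

/-- The position of an outcome triple in the truth table of a pattern. -/
def outcomeIndex (v : Fin 3 → Fin 2) : ℕ := v 0 + 2 * v 1 + 4 * v 2

/-- The outcome triple at a given position of the truth table of a pattern. -/
def outcomeOfIndex (j : ℕ) : Fin 3 → Fin 2 :=
  ![Fin.ofNat 2 j, Fin.ofNat 2 (j / 2), Fin.ofNat 2 (j / 4)]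

theorem outcomeOfIndex_outcomeIndex (v : Fin 3 → Fin 2) :
    outcomeOfIndex (outcomeIndex v) = v := by
  decide +revert

theorem outcomeIndex_lt (v : Fin 3 → Fin 2) : outcomeIndex v < 8 := by
  unfold outcomeIndex
  omega

/-- The triangle pattern whose truth table is given by the binary digits of `n`. -/
def patternOfCode (n : ℕ) : (Fin 3 → Fin 2) → Bool :=
  fun v => n.testBit (outcomeIndex v)

theorem exists_patternOfCode_eq (P : (Fin 3 → Fin 2) → Bool) :
    ∃ n < 256, patternOfCode n = P := by
  refine ⟨Nat.ofBits fun j : Fin 8 => P (outcomeOfIndex j), Nat.ofBits_lt_two_pow _, ?_⟩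
  funext v
  simp [patternOfCode, Nat.testBit_ofBits_lt _ _ (outcomeIndex_lt v),
    outcomeOfIndex_outcomeIndex]

theorem patternOfCode_injOn {m n : ℕ} (hm : m < 256) (hn : n < 256)
    (h : patternOfCode m = patternOfCode n) : m = n := by
  refine Nat.eq_of_testBit_eq fun j => ?_
  by_cases hj : j < 8
  · have hidx : ∀ j < 8, outcomeIndex (outcomeOfIndex j) = j := by decide
    simpa only [patternOfCode, hidx j hj] using congrFun h (outcomeOfIndex j)
  · have hpow : 256 ≤ 2 ^ j := Nat.pow_le_pow_right (n := 2) two_pos (not_lt.1 hj)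
    rw [Nat.testBit_eq_false_of_lt (hm.trans_le hpow),
      Nat.testBit_eq_false_of_lt (hn.trans_le hpow)]

/-- The code of a pattern after permuting the observers by `σ` and flipping outcomes by `f`. -/
def relabelCode (σ : Fin 3 → Fin 3) (f : Fin 3 → Fin 2) (n : ℕ) : ℕ :=
  Nat.ofBits fun j : Fin 8 => n.testBit (outcomeIndex fun i => outcomeOfIndex j (σ i) + f i)

theorem relabelCode_lt (σ : Fin 3 → Fin 3) (f : Fin 3 → Fin 2) (n : ℕ) :
    relabelCode σ f n < 256 :=
  Nat.ofBits_lt_two_pow _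

theorem patternOfCode_relabelCode (σ : Fin 3 → Fin 3) (f : Fin 3 → Fin 2) (n : ℕ)
    (v : Fin 3 → Fin 2) :
    patternOfCode (relabelCode σ f n) v = patternOfCode n fun i => v (σ i) + f i := by
  simp [patternOfCode, relabelCode, Nat.testBit_ofBits_lt _ _ (outcomeIndex_lt v),
    outcomeOfIndex_outcomeIndex]

/-- The permutations of the three observers. -/
def observerPerms : List (Fin 3 → Fin 3) :=
  [![0, 1, 2], ![1, 0, 2], ![0, 2, 1], ![2, 1, 0], ![1, 2, 0], ![2, 0, 1]]

theorem mem_observerPerms {σ : Fin 3 → Fin 3} : σ ∈ observerPerms ↔ σ.Injective := by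
  decide +revert

theorem triRel_patternOfCode_iff {m n : ℕ} (hn : n < 256) :
    triRel (patternOfCode m) (patternOfCode n) ↔
      ∃ σ ∈ observerPerms, ∃ p q r : Fin 2, relabelCode σ ![p, q, r] m = n := by
  rw [triRel_iff_exists_add]
  constructor
  · rintro ⟨σ, f, hσ, h⟩
    refine ⟨σ, mem_observerPerms.2 hσ, f 0, f 1, f 2,
      patternOfCode_injOn (relabelCode_lt _ _ _) hn (funext fun v => ?_)⟩
    have hf : ![f 0, f 1, f 2] = f := by
      ext i
      fin_cases i <;> rfl
    rw [hf, patternOfCode_relabelCode, h]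
  · rintro ⟨σ, hσ, p, q, r, rfl⟩
    exact ⟨σ, ![p, q, r], mem_observerPerms.1 hσ, patternOfCode_relabelCode σ _ m⟩

/-- The codes of the least representatives of the orbits of nonzero patterns. -/
def orbitCodes : Finset ℕ :=
  {1, 3, 6, 7, 15, 22, 23, 24, 25, 27, 30, 31, 60, 61, 63, 105, 107, 111, 126, 127, 255}

theorem lt_of_mem_orbitCodes : ∀ r ∈ orbitCodes, r < 256 := by
  decide

theorem exists_relabelCode_mem_orbitCodes :
    ∀ n < 256, n ≠ 0 → ∃ σ ∈ observerPerms, ∃ p q r : Fin 2,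
      relabelCode σ ![p, q, r] n ∈ orbitCodes := by
  decide +kernel

theorem relabelCode_eq_self_of_mem_orbitCodes :
    ∀ m ∈ orbitCodes, ∀ σ ∈ observerPerms, ∀ p q r : Fin 2,
      relabelCode σ ![p, q, r] m ∈ orbitCodes → relabelCode σ ![p, q, r] m = m := by
  decide +kernel

theorem exists_orbitCodes_triRel {n : ℕ} (hn : n < 256) (hn0 : n ≠ 0) :
    ∃ r ∈ orbitCodes, triRel (patternOfCode n) (patternOfCode r) := by
  obtain ⟨σ, hσ, p, q, r, h⟩ := exists_relabelCode_mem_orbitCodes n hn hn0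
  exact ⟨_, h, (triRel_patternOfCode_iff (relabelCode_lt _ _ _)).2 ⟨σ, hσ, p, q, r, rfl⟩⟩

theorem eq_of_triRel_of_mem_orbitCodes {m n : ℕ} (hm : m ∈ orbitCodes) (hn : n ∈ orbitCodes)
    (h : triRel (patternOfCode m) (patternOfCode n)) : m = n := by
  obtain ⟨σ, hσ, p, q, r, rfl⟩ :=
    (triRel_patternOfCode_iff (lt_of_mem_orbitCodes n hn)).1 h
  exact (relabelCode_eq_self_of_mem_orbitCodes m hm σ hσ p q r hn).symm

theorem patternOfCode_ne_false_of_mem_orbitCodes :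
    ∀ r ∈ orbitCodes, patternOfCode r ≠ fun _ => false := by
  decide +kernel

theorem setOf_triOrbit_eq_image :
    {O : Set ((Fin 3 → Fin 2) → Bool) |
      ∃ P : (Fin 3 → Fin 2) → Bool, P ≠ (fun _ => false) ∧ O = triOrbit P} =
    (fun r => triOrbit (patternOfCode r)) '' (orbitCodes : Set ℕ) := by
  ext O
  constructor
  · rintro ⟨P, hP, rfl⟩
    obtain ⟨n, hn, rfl⟩ := exists_patternOfCode_eq P
    have hn0 : n ≠ 0 := by
      rintro rfl
      exact hP (funext fun v => Nat.zero_testBit _)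
    obtain ⟨r, hr, h⟩ := exists_orbitCodes_triRel hn hn0
    exact ⟨r, hr, (triOrbit_eq_iff.2 h).symm⟩
  · rintro ⟨r, hr, rfl⟩
    exact ⟨_, patternOfCode_ne_false_of_mem_orbitCodes r hr, rfl⟩

/-- In the triangle scenario, the 255 patterns that are not identically false
decompose into exactly 21 orbits under the relabeling group. -/
theorem triangle_pattern_orbit_count :
    Nat.card {P : (Fin 3 → Fin 2) → Bool // P ≠ fun _ => false} = 255 ∧
    Set.ncard {O : Set ((Fin 3 → Fin 2) → Bool) |
      ∃ P : (Fin 3 → Fin 2) → Bool,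
        P ≠ (fun _ => false) ∧ O = triOrbit P} = 21 := by
  refine ⟨?_, ?_⟩
  · rw [Nat.card_eq_fintype_card, Fintype.card_subtype_compl, Fintype.card_subtype_eq]
    simp
  · rw [setOf_triOrbit_eq_image, Set.InjOn.ncard_image, Set.ncard_coe_finset]
    · rfl
    · intro r hr s hs h
      exact eq_of_triRel_of_mem_orbitCodes hr hs (triOrbit_eq_iff.1 h)
end

section
/- In the square scenario, say a pattern 𝖯 : (Fin 2)⁴ → Bool satisfies the factorization condition if for all outcomes: 𝖯_{AC}(a,c) = 𝖯_A(a) ∧ 𝖯_C(c) and 𝖯_{BD}(b,d) = 𝖯_B(b) ∧ 𝖯_D(d), where possibilistic marginals are defined by disjunction, e.g. 𝖯_{AC}(a,c) = ⋁_{b,d} 𝖯(a,b,c,d) and 𝖯_A(a) = ⋁_{b,c,d} 𝖯(a,b,c,d). This condition is invariant under the relabeling group G of the square scenario, and among the 804 orbits of not-identically-false patterns under G, exactly 519 orbits consist of patterns satisfying the factorization condition (equivalently, exactly 285 orbits fail it). -/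
/-- Adjacency in the 4-cycle A–B–C–D–A on `Fin 4`. -/
def cycAdj (i j : Fin 4) : Prop := j = i + 1 ∨ i = j + 1

/-- Two square patterns are related by a relabeling: a symmetry of the square
(an adjacency-preserving permutation of the four observers, i.e. an element of
the dihedral group `D₈` of order 8) together with an independent relabeling of
each observer's binary outcome. -/
def sqRel (P Q : (Fin 4 → Fin 2) → Bool) : Prop :=
  ∃ (σ : Equiv.Perm (Fin 4)) (π : Fin 4 → Equiv.Perm (Fin 2)),
    (∀ i j, cycAdj (σ i) (σ j) ↔ cycAdj i j) ∧
    ∀ v : Fin 4 → Fin 2, Q v = P fun i => π i (v (σ i))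

/-- The orbit of a square pattern under the relabeling group. -/
def sqOrbit (P : (Fin 4 → Fin 2) → Bool) : Set ((Fin 4 → Fin 2) → Bool) :=
  {Q | sqRel P Q}

/-- The possibilistic factorization condition in the square scenario:
`𝖯_AC(a,c) = 𝖯_A(a) ∧ 𝖯_C(c)` and `𝖯_BD(b,d) = 𝖯_B(b) ∧ 𝖯_D(d)`, where the
possibilistic marginals are disjunctions over the omitted coordinates
(observers A, B, C, D are the coordinates 0, 1, 2, 3). -/
def FactCond (P : (Fin 4 → Fin 2) → Bool) : Prop :=
  (∀ a c : Fin 2,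
    ((∃ v, P v = true ∧ v 0 = a ∧ v 2 = c) ↔
      ((∃ v, P v = true ∧ v 0 = a) ∧ (∃ v, P v = true ∧ v 2 = c)))) ∧
  (∀ b d : Fin 2,
    ((∃ v, P v = true ∧ v 1 = b ∧ v 3 = d) ↔
      ((∃ v, P v = true ∧ v 1 = b) ∧ (∃ v, P v = true ∧ v 3 = d))))

/-! ### Bit-mask encoding of square patterns -/

/-- Position of an outcome quadruple in a 16-bit mask. -/
def sqIndex (v : Fin 4 → Fin 2) : ℕ :=
  (v 0).val + 2 * (v 1).val + 4 * (v 2).val + 8 * (v 3).val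

/-- The pattern whose truth table is the 16-bit mask `n`. -/
def ofMask (n : ℕ) (v : Fin 4 → Fin 2) : Bool := n.testBit (sqIndex v)

/-- Keeps the bits of `n` in `k` and exchanges each bit of `n` in `m` with the bit `d` places
higher. -/
def deltaSwap (k m d n : ℕ) : ℕ :=
  Nat.lor (Nat.land n k)
    (Nat.lor (Nat.shiftLeft (Nat.land n m) d) (Nat.land (Nat.shiftRight n d) m))

/-- `f n`, written so that the kernel evaluates `n` before substituting it. -/
def strictApply {α : Type} (f : ℕ → α) (n : ℕ) : α :=
  Nat.rec (f 0) (fun m _ => f (Nat.succ m)) n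

/-- `p` holds at `n` and at `f n`. -/
def holdsBoth (f : ℕ → ℕ) (p : ℕ → Bool) (n : ℕ) : Bool :=
  Bool.rec false (strictApply p (f n)) (p n)

/-- Applies `f` if `b` is true. -/
def applyIf (b : Bool) (f : ℕ → ℕ) (n : ℕ) : ℕ := cond b (f n) n

/-- Flips the outcome of observer A. -/
def flipA : ℕ → ℕ := deltaSwap 0 21845 1

/-- Flips the outcome of observer B. -/
def flipB : ℕ → ℕ := deltaSwap 0 13107 2

/-- Flips the outcome of observer C. -/
def flipC : ℕ → ℕ := deltaSwap 0 3855 4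

/-- Flips the outcome of observer D. -/
def flipD : ℕ → ℕ := deltaSwap 0 255 8

/-- Exchanges the observers A and C. -/
def swapAC : ℕ → ℕ := deltaSwap 42405 2570 3

/-- Exchanges the observers B and D. -/
def swapBD : ℕ → ℕ := deltaSwap 52275 204 6

/-- Exchanges A with B and C with D. -/
def swapPairs (n : ℕ) : ℕ := deltaSwap 61455 240 4 (deltaSwap 39321 8738 1 n)

/-- The mask `n` is the least one in its orbit. -/
def isLeastMask (n : ℕ) : Bool :=
  holdsBoth flipD (holdsBoth flipC (holdsBoth flipB (holdsBoth flipA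
    (holdsBoth swapAC (holdsBoth swapBD (holdsBoth swapPairs (Nat.ble n))))))) n

/-- The number of `n` with binary expansion `a` followed by `k` digits such that `p n`. -/
def countBits (p : ℕ → Bool) : ℕ → ℕ → ℕ
  | 0, a => cond (p a) 1 0
  | k + 1, a => strictApply (countBits p k) (2 * a) + strictApply (countBits p k) (2 * a + 1)

/-- Possibilistic factorization of the two diagonals, on masks. -/
def factMask (n : ℕ) : Bool :=
  let ex (p : ℕ → Bool) : Bool := p 0 || p 1
  let all (p : ℕ → Bool) : Bool := p 0 && p 1
  let q (a b c d : ℕ) : Bool := n.testBit (a + 2 * b + 4 * c + 8 * d)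
  (all fun a => all fun c =>
    (ex fun b => ex fun d => q a b c d) ==
      ((ex fun b => ex fun c => ex fun d => q a b c d) &&
        (ex fun a => ex fun b => ex fun d => q a b c d))) &&
  (all fun b => all fun d =>
    (ex fun a => ex fun c => q a b c d) ==
      ((ex fun a => ex fun c => ex fun d => q a b c d) &&
        (ex fun a => ex fun b => ex fun c => q a b c d)))

theorem strictApply_eq {α : Type} (f : ℕ → α) (n : ℕ) : strictApply f n = f n := by
  cases n <;> rfl

theorem holdsBoth_iff (f : ℕ → ℕ) (p : ℕ → Bool) (n : ℕ) :
    holdsBoth f p n = true ↔ ∀ b, p (applyIf b f n) = true := by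
  simp only [holdsBoth, strictApply_eq, Bool.forall_bool, applyIf, cond_true, cond_false]
  cases p n <;> simp

theorem countBits_eq (p : ℕ → Bool) (k a : ℕ) :
    countBits p k a = ((Finset.Ico (a * 2 ^ k) ((a + 1) * 2 ^ k)).filter (p · = true)).card := by
  induction k generalizing a with
  | zero =>
    simp only [countBits, pow_zero, mul_one, Nat.Ico_succ_singleton, Finset.filter_singleton]
    cases p a <;> simp
  | succ k ih =>
    rw [countBits, strictApply_eq, strictApply_eq, ih, ih, ← Finset.card_union_of_disjoint,
      ← Finset.filter_union, Finset.Ico_union_Ico_eq_Ico]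
    · congr 3 <;> ring
    · gcongr; omega
    · gcongr; omega
    · exact Finset.disjoint_filter_filter
        (Finset.Ico_disjoint_Ico_consecutive _ ((2 * a + 1) * 2 ^ k) _)

theorem testBit_deltaSwap (k m d n i : ℕ) :
    (deltaSwap k m d n).testBit i = (n.testBit i && k.testBit i ||
      (decide (d ≤ i) && (n.testBit (i - d) && m.testBit (i - d)) ||
        n.testBit (d + i) && m.testBit i)) := by
  have h : deltaSwap k m d n = (n &&& k) ||| (((n &&& m) <<< d) ||| ((n >>> d) &&& m)) := rfl
  simp [h]

theorem deltaSwap_lt {k m d : ℕ} (hk : k < 2 ^ 16) (hm : m < 2 ^ 16)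
    (hd : m * 2 ^ d < 2 ^ 16) (n : ℕ) : deltaSwap k m d n < 2 ^ 16 := by
  refine Nat.or_lt_two_pow (Nat.and_lt_two_pow _ hk)
    (Nat.or_lt_two_pow ?_ (Nat.and_lt_two_pow _ hm))
  have h : (n &&& m) * 2 ^ d < 2 ^ 16 := (Nat.mul_le_mul_right _ Nat.and_le_right).trans_lt hd
  rwa [← Nat.shiftLeft_eq] at h

theorem applyIf_lt {b : Bool} {f : ℕ → ℕ} {N n : ℕ} (hf : ∀ m, f m < N) (hn : n < N) :
    applyIf b f n < N := by
  cases b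
  exacts [hn, hf n]

/-- The relabeling of binary outcomes given by a bit. -/
def outcomePerm (b : Bool) : Equiv.Perm (Fin 2) := cond b (Equiv.swap 0 1) 1

theorem exists_outcomePerm : ∀ π : Equiv.Perm (Fin 2), ∃ b, outcomePerm b = π := by decide

/-- Applies a permutation of the observers if `b` is true. -/
def permIf (b : Bool) (σ : Equiv.Perm (Fin 4)) : Equiv.Perm (Fin 4) := cond b σ 1

instance (i j : Fin 4) : Decidable (cycAdj i j) := inferInstanceAs (Decidable (_ ∨ _))

/-- The symmetries of the square. -/
def squarePerm (r s t : Bool) : Equiv.Perm (Fin 4) :=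
  permIf r (Equiv.swap 2 3 * Equiv.swap 0 1) * permIf s (Equiv.swap 1 3) *
    permIf t (Equiv.swap 0 2)

theorem cycAdj_squarePerm : ∀ r s t i j,
    cycAdj (squarePerm r s t i) (squarePerm r s t j) ↔ cycAdj i j := by decide

theorem exists_squarePerm : ∀ σ : Equiv.Perm (Fin 4),
    (∀ i j, cycAdj (σ i) (σ j) ↔ cycAdj i j) → ∃ r s t, squarePerm r s t = σ := by decide

theorem ofMask_deltaSwap {k m d : ℕ} {γ : (Fin 4 → Fin 2) → Fin 4 → Fin 2}
    (h : ∀ v,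
      (k.testBit (sqIndex v) → sqIndex (γ v) = sqIndex v) ∧
      (d ≤ sqIndex v ∧ m.testBit (sqIndex v - d) → sqIndex (γ v) = sqIndex v - d) ∧
      (m.testBit (sqIndex v) → sqIndex (γ v) = d + sqIndex v) ∧
      (k.testBit (sqIndex v) ∨ (d ≤ sqIndex v ∧ m.testBit (sqIndex v - d)) ∨
        m.testBit (sqIndex v)))
    (n : ℕ) (v : Fin 4 → Fin 2) : ofMask (deltaSwap k m d n) v = ofMask n (γ v) := by
  have := h v
  rw [ofMask, ofMask, testBit_deltaSwap, Bool.eq_iff_iff]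
  simp only [Bool.or_eq_true, Bool.and_eq_true, decide_eq_true_eq]
  grind

theorem ofMask_flip {f : ℕ → ℕ} {i : Fin 4}
    (h : ∀ n v, ofMask (f n) v = ofMask n (Function.update v i (Equiv.swap 0 1 (v i))))
    (b : Bool) (n : ℕ) (v : Fin 4 → Fin 2) :
    ofMask (applyIf b f n) v = ofMask n (Function.update v i (outcomePerm b (v i))) := by
  cases b
  · simp [applyIf, outcomePerm]
  · exact h n v

theorem ofMask_perm {f : ℕ → ℕ} {σ : Equiv.Perm (Fin 4)}
    (h : ∀ n v, ofMask (f n) v = ofMask n (v ∘ σ)) (b : Bool) (n : ℕ) (v : Fin 4 → Fin 2) :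
    ofMask (applyIf b f n) v = ofMask n (v ∘ permIf b σ) := by
  cases b
  · rfl
  · exact h n v

theorem ofMask_flipA (n : ℕ) (v : Fin 4 → Fin 2) :
    ofMask (flipA n) v = ofMask n (Function.update v 0 (Equiv.swap 0 1 (v 0))) :=
  ofMask_deltaSwap (γ := fun v => Function.update v 0 (Equiv.swap 0 1 (v 0))) (by decide) n v

theorem ofMask_flipB (n : ℕ) (v : Fin 4 → Fin 2) :
    ofMask (flipB n) v = ofMask n (Function.update v 1 (Equiv.swap 0 1 (v 1))) :=
  ofMask_deltaSwap (γ := fun v => Function.update v 1 (Equiv.swap 0 1 (v 1))) (by decide) n v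

theorem ofMask_flipC (n : ℕ) (v : Fin 4 → Fin 2) :
    ofMask (flipC n) v = ofMask n (Function.update v 2 (Equiv.swap 0 1 (v 2))) :=
  ofMask_deltaSwap (γ := fun v => Function.update v 2 (Equiv.swap 0 1 (v 2))) (by decide) n v

theorem ofMask_flipD (n : ℕ) (v : Fin 4 → Fin 2) :
    ofMask (flipD n) v = ofMask n (Function.update v 3 (Equiv.swap 0 1 (v 3))) :=
  ofMask_deltaSwap (γ := fun v => Function.update v 3 (Equiv.swap 0 1 (v 3))) (by decide) n v

theorem ofMask_swapAC (n : ℕ) (v : Fin 4 → Fin 2) :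
    ofMask (swapAC n) v = ofMask n (v ∘ Equiv.swap 0 2) :=
  ofMask_deltaSwap (γ := fun v => v ∘ Equiv.swap 0 2) (by decide) n v

theorem ofMask_swapBD (n : ℕ) (v : Fin 4 → Fin 2) :
    ofMask (swapBD n) v = ofMask n (v ∘ Equiv.swap 1 3) :=
  ofMask_deltaSwap (γ := fun v => v ∘ Equiv.swap 1 3) (by decide) n v

theorem ofMask_swapPairs (n : ℕ) (v : Fin 4 → Fin 2) :
    ofMask (swapPairs n) v =
      ofMask n (v ∘ (Equiv.swap 2 3 * Equiv.swap 0 1 : Equiv.Perm (Fin 4))) :=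
  (ofMask_deltaSwap (γ := fun v => v ∘ Equiv.swap 2 3) (by decide) _ v).trans
    (ofMask_deltaSwap (γ := fun v => v ∘ Equiv.swap 0 1) (by decide) n _)

/-- The action on masks of the relabeling with flips `a b c d` and symmetry `squarePerm r s t`. -/
def relabelMask (a b c d r s t : Bool) (n : ℕ) : ℕ :=
  applyIf r swapPairs (applyIf s swapBD (applyIf t swapAC
    (applyIf a flipA (applyIf b flipB (applyIf c flipC (applyIf d flipD n))))))

theorem ofMask_relabelMask (a b c d r s t : Bool) (n : ℕ) (v : Fin 4 → Fin 2) :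
    ofMask (relabelMask a b c d r s t n) v =
      ofMask n fun i => outcomePerm (![a, b, c, d] i) (v (squarePerm r s t i)) := by
  rw [relabelMask, ofMask_perm ofMask_swapPairs, ofMask_perm ofMask_swapBD,
    ofMask_perm ofMask_swapAC, ofMask_flip ofMask_flipA, ofMask_flip ofMask_flipB,
    ofMask_flip ofMask_flipC, ofMask_flip ofMask_flipD]
  congr 1
  ext i
  fin_cases i <;> simp [squarePerm]

theorem relabelMask_lt (a b c d r s t : Bool) {n : ℕ} (hn : n < 2 ^ 16) :
    relabelMask a b c d r s t n < 2 ^ 16 := by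
  unfold relabelMask
  repeat refine applyIf_lt (fun m => deltaSwap_lt (by norm_num) (by norm_num) (by norm_num) _) ?_
  exact hn

theorem ofMask_injOn : Set.InjOn ofMask {n | n < 2 ^ 16} := by
  intro m hm n hn h
  refine Nat.eq_of_testBit_eq fun i => ?_
  rcases lt_or_ge i 16 with hi | hi
  · have : ∀ i : Fin 16, ∃ v, sqIndex v = i := by decide
    obtain ⟨v, hv⟩ := this ⟨i, hi⟩
    simpa [ofMask, hv] using congrFun h v
  · have hp : 2 ^ 16 ≤ 2 ^ i := Nat.pow_le_pow_right two_pos hi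
    rw [Nat.testBit_lt_two_pow (lt_of_lt_of_le hm hp),
      Nat.testBit_lt_two_pow (lt_of_lt_of_le hn hp)]

theorem exists_ofMask (P : (Fin 4 → Fin 2) → Bool) : ∃ n < 2 ^ 16, ofMask n = P := by
  have h : Function.Bijective fun n : Fin (2 ^ 16) => ofMask n :=
    (Fintype.bijective_iff_injective_and_card _).2
      ⟨fun m n h => Fin.ext (ofMask_injOn m.2 n.2 h), by simp⟩
  obtain ⟨n, hn⟩ := h.2 P
  exact ⟨n, n.2, hn⟩

theorem sqRel.refl (P : (Fin 4 → Fin 2) → Bool) : sqRel P P :=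
  ⟨1, 1, by simp, fun _ => rfl⟩

theorem sqRel.symm {P Q : (Fin 4 → Fin 2) → Bool} : sqRel P Q → sqRel Q P := by
  rintro ⟨σ, π, hσ, h⟩
  refine ⟨σ⁻¹, fun i => (π (σ⁻¹ i))⁻¹, fun i j => ?_, fun v => ?_⟩
  · simpa using (hσ (σ⁻¹ i) (σ⁻¹ j)).symm
  · simp [h]

theorem sqRel.trans {P Q R : (Fin 4 → Fin 2) → Bool} : sqRel P Q → sqRel Q R → sqRel P R := by
  rintro ⟨σ, π, hσ, h⟩ ⟨τ, ρ, hτ, k⟩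
  refine ⟨τ * σ, fun i => π i * ρ (σ i), fun i j => ?_, fun v => ?_⟩
  · simpa using (hτ _ _).trans (hσ i j)
  · simp [h, k]

theorem sqOrbit_eq_iff {P Q : (Fin 4 → Fin 2) → Bool} : sqOrbit P = sqOrbit Q ↔ sqRel P Q := by
  refine ⟨fun h => ?_, fun h => Set.ext fun R => ⟨h.symm.trans, h.trans⟩⟩
  have : Q ∈ sqOrbit P := h ▸ sqRel.refl Q
  exact this

theorem sqRel_ofMask_iff {m n : ℕ} (hm : m < 2 ^ 16) (hn : n < 2 ^ 16) :
    sqRel (ofMask n) (ofMask m) ↔ ∃ d c b a t s r, relabelMask a b c d r s t n = m := by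
  constructor
  · rintro ⟨σ, π, hσ, h⟩
    obtain ⟨r, s, t, rfl⟩ := exists_squarePerm σ hσ
    choose x hx using fun i => exists_outcomePerm (π i)
    refine ⟨x 3, x 2, x 1, x 0, t, s, r,
      ofMask_injOn (relabelMask_lt _ _ _ _ _ _ _ hn) hm (funext fun v => ?_)⟩
    rw [ofMask_relabelMask, h]
    congr 1
    ext i
    fin_cases i <;> simp [hx]
  · rintro ⟨d, c, b, a, t, s, r, rfl⟩
    exact ⟨_, _, cycAdj_squarePerm r s t, ofMask_relabelMask a b c d r s t n⟩

theorem isLeastMask_iff {n : ℕ} (hn : n < 2 ^ 16) :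
    isLeastMask n = true ↔ ∀ m < 2 ^ 16, sqRel (ofMask n) (ofMask m) → n ≤ m := by
  have h : isLeastMask n = true ↔ ∀ d c b a t s r, n ≤ relabelMask a b c d r s t n := by
    simp only [isLeastMask, holdsBoth_iff, Nat.ble_eq, relabelMask]
  rw [h]
  constructor
  · intro h m hm hr
    obtain ⟨d, c, b, a, t, s, r, rfl⟩ := (sqRel_ofMask_iff hm hn).1 hr
    exact h d c b a t s r
  · intro h d c b a t s r
    have hlt := relabelMask_lt a b c d r s t hn
    exact h _ hlt ((sqRel_ofMask_iff hlt hn).2 ⟨d, c, b, a, t, s, r, rfl⟩)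

/-- The orbits of patterns with an invariant property are counted by their least masks. -/
theorem ncard_orbits {C : ((Fin 4 → Fin 2) → Bool) → Prop}
    (hC : ∀ P Q, sqRel P Q → (C P ↔ C Q)) {c : ℕ → Bool}
    (hc : ∀ n < 2 ^ 16, c n = true ↔ C (ofMask n)) :
    Set.ncard {O : Set ((Fin 4 → Fin 2) → Bool) | ∃ P, C P ∧ O = sqOrbit P} =
      countBits (fun n => isLeastMask n && c n) 16 0 := by
  rw [countBits_eq, ← Set.ncard_coe_finset]
  symm
  refine Set.ncard_congr (fun n _ => sqOrbit (ofMask n)) ?_ ?_ ?_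
  · intro n hn
    simp only [Finset.coe_filter, Set.mem_ofPred_eq, Bool.and_eq_true] at hn
    exact ⟨_, (hc n (by simpa using (Finset.mem_Ico.1 hn.1).2)).1 hn.2.2, rfl⟩
  · intro m n hm hn h
    simp only [Finset.coe_filter, Set.mem_ofPred_eq, Bool.and_eq_true, Finset.mem_Ico, zero_mul,
      zero_add, one_mul] at hm hn
    have hr := sqOrbit_eq_iff.1 h
    exact le_antisymm ((isLeastMask_iff hm.1.2).1 hm.2.1 n hn.1.2 hr)
      ((isLeastMask_iff hn.1.2).1 hn.2.1 m hm.1.2 hr.symm)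
  · rintro _ ⟨P, hP, rfl⟩
    classical
    have hex : ∃ n, n < 2 ^ 16 ∧ sqRel P (ofMask n) := by
      obtain ⟨n, hn, rfl⟩ := exists_ofMask P
      exact ⟨n, hn, sqRel.refl _⟩
    obtain ⟨hlt, hr⟩ := Nat.find_spec hex
    refine ⟨Nat.find hex, ?_, (sqOrbit_eq_iff.2 hr).symm⟩
    simp only [Finset.coe_filter, Set.mem_ofPred_eq, Bool.and_eq_true, Finset.mem_Ico, zero_mul,
      zero_add, one_mul]
    exact ⟨⟨Nat.zero_le _, hlt⟩,
      (isLeastMask_iff hlt).2 fun m hm h => Nat.find_min' hex ⟨hm, hr.trans h⟩,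
      (hc _ hlt).2 ((hC _ _ hr).1 hP)⟩

/-- Possibilistic independence of the observers `i` and `j`. -/
def FactPair (P : (Fin 4 → Fin 2) → Bool) (i j : Fin 4) : Prop :=
  ∀ a c : Fin 2, (∃ v, P v = true ∧ v i = a ∧ v j = c) ↔
    (∃ v, P v = true ∧ v i = a) ∧ (∃ v, P v = true ∧ v j = c)

theorem FactPair.symm {P : (Fin 4 → Fin 2) → Bool} {i j : Fin 4} (h : FactPair P i j) :
    FactPair P j i := fun a c => by
  rw [and_comm (a := ∃ v, P v = true ∧ v j = a), ← h c a]
  simp only [and_comm (a := _ = c)]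

theorem FactPair.relabel {P Q : (Fin 4 → Fin 2) → Bool} {σ : Equiv.Perm (Fin 4)}
    {π : Fin 4 → Equiv.Perm (Fin 2)} (h : ∀ v, Q v = P fun i => π i (v (σ i))) {i j : Fin 4}
    (hP : FactPair P i j) : FactPair Q (σ i) (σ j) := by
  have key (p : (Fin 4 → Fin 2) → Prop) :
      (∃ v, Q v = true ∧ p fun i => π i (v (σ i))) ↔ ∃ w, P w = true ∧ p w := by
    constructor
    · rintro ⟨v, hv, hp⟩
      exact ⟨_, h v ▸ hv, hp⟩
    · rintro ⟨w, hw, hp⟩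
      refine ⟨fun k => (π (σ⁻¹ k))⁻¹ (w (σ⁻¹ k)), ?_, ?_⟩ <;> simpa [h]
  intro a c
  have h₁ := key fun w => w i = π i a ∧ w j = π j c
  have h₂ := key fun w => w i = π i a
  have h₃ := key fun w => w j = π j c
  simp only [EmbeddingLike.apply_eq_iff_eq] at h₁ h₂ h₃
  rw [h₁, h₂, h₃]
  exact hP _ _

theorem FactCond.of_sqRel {P Q : (Fin 4 → Fin 2) → Bool} (hPQ : sqRel P Q) (hP : FactCond P) :
    FactCond Q := by
  obtain ⟨σ, π, hσ, h⟩ := hPQ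
  have h₁ : FactPair Q (σ 0) (σ 2) := FactPair.relabel h hP.1
  have h₂ : FactPair Q (σ 1) (σ 3) := FactPair.relabel h hP.2
  have hcases : ∀ σ : Equiv.Perm (Fin 4), (∀ i j, cycAdj (σ i) (σ j) ↔ cycAdj i j) →
      (σ 0 = 0 ∧ σ 2 = 2 ∨ σ 0 = 2 ∧ σ 2 = 0) ∧ (σ 1 = 1 ∧ σ 3 = 3 ∨ σ 1 = 3 ∧ σ 3 = 1) ∨
      (σ 0 = 1 ∧ σ 2 = 3 ∨ σ 0 = 3 ∧ σ 2 = 1) ∧ (σ 1 = 0 ∧ σ 3 = 2 ∨ σ 1 = 2 ∧ σ 3 = 0) := by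
    decide
  suffices FactPair Q 0 2 ∧ FactPair Q 1 3 from this
  rcases hcases σ hσ with ⟨h₀₂ | h₀₂, h₁₃ | h₁₃⟩ | ⟨h₀₂ | h₀₂, h₁₃ | h₁₃⟩ <;>
    rw [h₀₂.1, h₀₂.2] at h₁ <;> rw [h₁₃.1, h₁₃.2] at h₂
  exacts [⟨h₁, h₂⟩, ⟨h₁, h₂.symm⟩, ⟨h₁.symm, h₂⟩, ⟨h₁.symm, h₂.symm⟩,
    ⟨h₂, h₁⟩, ⟨h₂.symm, h₁⟩, ⟨h₂, h₁.symm⟩, ⟨h₂.symm, h₁.symm⟩]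

theorem factCond_iff_of_sqRel {P Q : (Fin 4 → Fin 2) → Bool} (h : sqRel P Q) :
    FactCond P ↔ FactCond Q :=
  ⟨.of_sqRel h, .of_sqRel h.symm⟩

theorem ne_false_of_sqRel {P Q : (Fin 4 → Fin 2) → Bool} (hPQ : sqRel P Q)
    (hP : P ≠ fun _ => false) : Q ≠ fun _ => false := by
  rintro rfl
  obtain ⟨_, _, _, h⟩ := hPQ.symm
  exact hP (funext h)

theorem not_beq_zero_iff {n : ℕ} (hn : n < 2 ^ 16) :
    (!Nat.beq n 0) = true ↔ ofMask n ≠ fun _ => false := by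
  have h : (fun _ => false) = ofMask 0 := by ext v; simp [ofMask]
  rw [h, Ne, ofMask_injOn.eq_iff hn (by simp), Bool.not_eq_true', ← Bool.not_eq_true, Nat.beq_eq]

theorem exists_outcomes_iff {p : (Fin 4 → Fin 2) → Prop} :
    (∃ v, p v) ↔ ∃ a b c d, p ![a, b, c, d] := by
  refine ⟨fun ⟨v, hv⟩ => ⟨v 0, v 1, v 2, v 3, ?_⟩, fun ⟨a, b, c, d, h⟩ => ⟨_, h⟩⟩
  convert hv
  ext i
  fin_cases i <;> rfl

theorem factMask_iff (n : ℕ) : factMask n = true ↔ FactCond (ofMask n) := by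
  simp only [factMask, FactCond, exists_outcomes_iff, ofMask, sqIndex, Fin.forall_fin_two,
    Fin.exists_fin_two]
  have beq_iff (a b : Bool) : (a == b) = true ↔ (a = true ↔ b = true) := by
    rw [beq_iff_eq, Bool.eq_iff_iff]
  simp [beq_iff, -beq_iff_eq]

theorem count_fact :
    countBits (fun n => isLeastMask n && (!(Nat.beq n 0) && factMask n)) 16 0 = 519 := by
  decide +kernel

theorem count_not_fact :
    countBits (fun n => isLeastMask n && (!(Nat.beq n 0) && !factMask n)) 16 0 = 285 := by
  decide +kernel

/-- The factorization condition is invariant under the relabeling group of the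
square scenario, and among the 804 orbits of not-identically-false patterns,
exactly 519 consist of patterns satisfying it while exactly 285 fail it. -/
theorem square_factorization_orbit_count :
    (∀ P Q : (Fin 4 → Fin 2) → Bool, sqRel P Q → (FactCond P ↔ FactCond Q)) ∧
    Set.ncard {O : Set ((Fin 4 → Fin 2) → Bool) |
      ∃ P : (Fin 4 → Fin 2) → Bool,
        P ≠ (fun _ => false) ∧ FactCond P ∧ O = sqOrbit P} = 519 ∧
    Set.ncard {O : Set ((Fin 4 → Fin 2) → Bool) |
      ∃ P : (Fin 4 → Fin 2) → Bool,
        P ≠ (fun _ => false) ∧ ¬ FactCond P ∧ O = sqOrbit P} = 285 := by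
  refine ⟨fun P Q h => factCond_iff_of_sqRel h, ?_, ?_⟩
  · simp only [← and_assoc]
    rw [← count_fact]
    refine ncard_orbits (fun P Q h => ?_) fun n hn => ?_
    · exact and_congr ⟨ne_false_of_sqRel h, ne_false_of_sqRel h.symm⟩ (factCond_iff_of_sqRel h)
    · simp only [Bool.and_eq_true, not_beq_zero_iff hn, factMask_iff]
  · simp only [← and_assoc]
    rw [← count_not_fact]
    refine ncard_orbits (fun P Q h => ?_) fun n hn => ?_
    · exact and_congr ⟨ne_false_of_sqRel h, ne_false_of_sqRel h.symm⟩
        (not_congr (factCond_iff_of_sqRel h))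
    · simp only [Bool.and_eq_true, not_beq_zero_iff hn, ← factMask_iff, Bool.not_eq_true',
        Bool.not_eq_true]
end

section
/- (Hardy's possibilistic argument for bipartite local models.) Let Λ be a finite type, q a probability distribution on Λ, and for each λ ∈ Λ let A(· | x, λ) and B(· | y, λ) be probability distributions on Fin 2 for each input x, y ∈ Fin 2. Define the local correlation P(a,b | x,y) = Σ_λ q(λ)·A(a | x,λ)·B(b | y,λ). If P(1,0 | 1,0) = 0, P(0,1 | 0,1) = 0, and P(0,0 | 1,1) = 0, then P(0,0 | 0,0) = 0. -/
/-- Hardy's possibilistic argument: for any bipartite local hidden-variable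
model `P(a,b|x,y) = Σ_λ q(λ)·A(a|x,λ)·B(b|y,λ)`, if `P(1,0|1,0) = 0`,
`P(0,1|0,1) = 0` and `P(0,0|1,1) = 0`, then `P(0,0|0,0) = 0`. -/
theorem hardy_possibilistic_argument
    {Λ : Type*} [Fintype Λ]
    (q : Λ → ℝ) (hq0 : ∀ l, 0 ≤ q l) (hq1 : (∑ l, q l) = 1)
    (A : Fin 2 → Fin 2 → Λ → ℝ)
    (hA0 : ∀ a x l, 0 ≤ A a x l) (hA1 : ∀ x l, (∑ a, A a x l) = 1)
    (B : Fin 2 → Fin 2 → Λ → ℝ)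
    (hB0 : ∀ b y l, 0 ≤ B b y l) (hB1 : ∀ y l, (∑ b, B b y l) = 1)
    (P : Fin 2 → Fin 2 → Fin 2 → Fin 2 → ℝ)
    (hP : ∀ a b x y, P a b x y = ∑ l, q l * A a x l * B b y l)
    (h1 : P 1 0 1 0 = 0) (h2 : P 0 1 0 1 = 0) (h3 : P 0 0 1 1 = 0) :
    P 0 0 0 0 = 0 := by
  have hterm : ∀ a b x y, P a b x y = 0 → ∀ l, q l * A a x l * B b y l = 0 := by
    intro a b x y h l
    rw [hP, Finset.sum_eq_zero_iff_of_nonneg fun l _ =>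
      mul_nonneg (mul_nonneg (hq0 l) (hA0 a x l)) (hB0 b y l)] at h
    exact h l (Finset.mem_univ l)
  rw [hP]
  refine Finset.sum_eq_zero fun l _ => ?_
  by_contra hne
  obtain ⟨⟨hq, hA⟩, hB⟩ : (q l ≠ 0 ∧ A 0 0 l ≠ 0) ∧ B 0 0 l ≠ 0 := by
    simpa only [mul_ne_zero_iff] using hne
  have hA1l := hA1 1 l
  have hB1l := hB1 1 l
  have hA11 : A 1 1 l = 0 := by simpa [hq, hB] using hterm 1 0 1 0 h1 l
  have hB11 : B 1 1 l = 0 := by simpa [hq, hA] using hterm 0 1 0 1 h2 l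
  rw [Fin.sum_univ_two, hA11, add_zero] at hA1l
  rw [Fin.sum_univ_two, hB11, add_zero] at hB1l
  exact hq (by simpa [hA1l, hB1l] using hterm 0 0 1 1 h3 l)
end

section
/- In the triangle scenario with binary outcomes, hidden variables of cardinality 2 suffice at the possibilistic level: for every probability distribution P on (Fin 2)³ that is triangle-local with all three hidden-variable types of cardinality 6 (Ω_α = Ω_β = Ω_γ = Fin 6), there exists a probability distribution Q on (Fin 2)³ that is triangle-local with all three hidden-variable types of cardinality 2 (Ω_α = Ω_β = Ω_γ = Fin 2) and whose support equals the support of P. -/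
/-- `P` is triangle-local with hidden-variable types of cardinalities
`nα`, `nβ`, `nγ` for the sources α, β, γ. -/
def IsTriangleLocalWith (nα nβ nγ : ℕ) (P : Fin 2 → Fin 2 → Fin 2 → ℝ) : Prop :=
  ∃ (pα : Fin nα → ℝ) (pβ : Fin nβ → ℝ) (pγ : Fin nγ → ℝ)
    (PA : Fin 2 → Fin nβ → Fin nγ → ℝ)
    (PB : Fin 2 → Fin nγ → Fin nα → ℝ)
    (PC : Fin 2 → Fin nα → Fin nβ → ℝ),
    (∀ α, 0 ≤ pα α) ∧ (∑ α, pα α) = 1 ∧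
    (∀ β, 0 ≤ pβ β) ∧ (∑ β, pβ β) = 1 ∧
    (∀ γ, 0 ≤ pγ γ) ∧ (∑ γ, pγ γ) = 1 ∧
    (∀ a β γ, 0 ≤ PA a β γ) ∧ (∀ β γ, (∑ a, PA a β γ) = 1) ∧
    (∀ b γ α, 0 ≤ PB b γ α) ∧ (∀ γ α, (∑ b, PB b γ α) = 1) ∧
    (∀ c α β, 0 ≤ PC c α β) ∧ (∀ α β, (∑ c, PC c α β) = 1) ∧
    (∀ a b c, P a b c =
      ∑ α, ∑ β, ∑ γ, pα α * pβ β * pγ γ * PA a β γ * PB b γ α * PC c α β)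

/-! ### Possibilistic triangle patterns -/

section Pattern

variable {X Y Z O : Type*}

/-- The outcome triples made possible by a triangle of possible responses. -/
def TrianglePossible (A : O → Y → Z → Prop) (B : O → Z → X → Prop) (C : O → X → Y → Prop)
    (a b c : O) : Prop :=
  ∃ x y z, A a y z ∧ B b z x ∧ C c x y

/-- Any possible outcomes of the first two observers share a possible outcome of the third. -/
def ShareThirdOutcome (T : O → O → O → Prop) : Prop :=
  ∀ a b, (∃ b' c, T a b' c) → (∃ a' c, T a' b c) → ∃ c, (∃ b', T a b' c) ∧ ∃ a', T a' b c

/-- Any possible outcomes of the three observers are cyclically compatible with the entries of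
some possible triple. -/
def CyclicallyCompatible (T : O → O → O → Prop) : Prop :=
  ∀ a b c, (∃ b' c', T a b' c') → (∃ a' c', T a' b c') → (∃ a' b', T a' b' c) →
    ∃ a' b' c', T a' b' c' ∧ (∃ b'', T a' b'' c) ∧ (∃ c'', T a b' c'') ∧ ∃ a'', T a'' b c'

/-- The conditions which every nonempty pattern of a triangle satisfies, and which characterize
these patterns for binary outcomes. -/
def TriangleCompatible (T : O → O → O → Prop) : Prop :=
  (∃ a b c, T a b c) ∧ ShareThirdOutcome T ∧ ShareThirdOutcome (fun b c a => T a b c) ∧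
    ShareThirdOutcome (fun c a b => T a b c) ∧ CyclicallyCompatible T

variable {A : O → Y → Z → Prop} {B : O → Z → X → Prop} {C : O → X → Y → Prop}

instance [Fintype X] [Fintype Y] [Fintype Z] [∀ a y z, Decidable (A a y z)]
    [∀ b z x, Decidable (B b z x)] [∀ c x y, Decidable (C c x y)] (a b c : O) :
    Decidable (TrianglePossible A B C a b c) :=
  inferInstanceAs (Decidable (∃ x y z, A a y z ∧ B b z x ∧ C c x y))

instance [Fintype O] (T : O → O → O → Prop) [∀ a b c, Decidable (T a b c)] :
    Decidable (ShareThirdOutcome T) :=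
  inferInstanceAs (Decidable (∀ a b, (∃ b' c, T a b' c) → (∃ a' c, T a' b c) →
    ∃ c, (∃ b', T a b' c) ∧ ∃ a', T a' b c))

instance [Fintype O] (T : O → O → O → Prop) [∀ a b c, Decidable (T a b c)] :
    Decidable (CyclicallyCompatible T) :=
  inferInstanceAs (Decidable (∀ a b c,
    (∃ b' c', T a b' c') → (∃ a' c', T a' b c') → (∃ a' b', T a' b' c) →
    ∃ a' b' c', T a' b' c' ∧ (∃ b'', T a' b'' c) ∧ (∃ c'', T a b' c'') ∧ ∃ a'', T a'' b c'))

instance [Fintype O] (T : O → O → O → Prop) [∀ a b c, Decidable (T a b c)] :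
    Decidable (TriangleCompatible T) :=
  inferInstanceAs (Decidable ((∃ a b c, T a b c) ∧ ShareThirdOutcome T ∧
    ShareThirdOutcome (fun b c a => T a b c) ∧ ShareThirdOutcome (fun c a b => T a b c) ∧
    CyclicallyCompatible T))

theorem trianglePossible_rotate (a b c : O) :
    TrianglePossible A B C a b c ↔ TrianglePossible B C A b c a :=
  ⟨fun ⟨x, y, z, hA, hB, hC⟩ => ⟨y, z, x, hB, hC, hA⟩,
    fun ⟨y, z, x, hB, hC, hA⟩ => ⟨x, y, z, hA, hB, hC⟩⟩

theorem TrianglePossible.shareThirdOutcome (hA : ∀ y z, ∃ a, A a y z)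
    (hB : ∀ z x, ∃ b, B b z x) (hC : ∀ x y, ∃ c, C c x y) :
    ShareThirdOutcome (TrianglePossible A B C) := by
  rintro a b ⟨_, _, _, y, z, ha, _, _⟩ ⟨_, _, x, _, z', _, hb, _⟩
  obtain ⟨c, hc⟩ := hC x y
  obtain ⟨b', hb'⟩ := hB z x
  obtain ⟨a', ha'⟩ := hA y z'
  exact ⟨c, ⟨b', x, y, z, ha, hb', hc⟩, ⟨a', x, y, z', ha', hb, hc⟩⟩

theorem TrianglePossible.cyclicallyCompatible (hA : ∀ y z, ∃ a, A a y z)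
    (hB : ∀ z x, ∃ b, B b z x) (hC : ∀ x y, ∃ c, C c x y) :
    CyclicallyCompatible (TrianglePossible A B C) := by
  rintro a b c ⟨_, _, _, y₁, z₁, ha, _, _⟩ ⟨_, _, x₂, _, z₂, _, hb, _⟩ ⟨_, _, x₃, y₃, _, _, _, hc⟩
  obtain ⟨a', ha'⟩ := hA y₃ z₁
  obtain ⟨b', hb'⟩ := hB z₁ x₂
  obtain ⟨c', hc'⟩ := hC x₂ y₃
  obtain ⟨a'', ha''⟩ := hA y₃ z₂
  obtain ⟨b'', hb''⟩ := hB z₁ x₃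
  obtain ⟨c'', hc''⟩ := hC x₂ y₁
  exact ⟨a', b', c', ⟨x₂, y₃, z₁, ha', hb', hc'⟩, ⟨b'', x₃, y₃, z₁, ha', hb'', hc⟩,
    ⟨c'', x₂, y₁, z₁, ha, hb', hc''⟩, ⟨a'', x₂, y₃, z₂, ha'', hb, hc'⟩⟩

theorem TrianglePossible.triangleCompatible
    [hX : Nonempty X] [hY : Nonempty Y] [hZ : Nonempty Z]
    (hA : ∀ y z, ∃ a, A a y z) (hB : ∀ z x, ∃ b, B b z x) (hC : ∀ x y, ∃ c, C c x y) :
    TriangleCompatible (TrianglePossible A B C) := by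
  obtain ⟨x⟩ := hX
  obtain ⟨y⟩ := hY
  obtain ⟨z⟩ := hZ
  obtain ⟨a, ha⟩ := hA y z
  obtain ⟨b, hb⟩ := hB z x
  obtain ⟨c, hc⟩ := hC x y
  refine ⟨⟨a, b, c, x, y, z, ha, hb, hc⟩, shareThirdOutcome hA hB hC, ?_, ?_,
    cyclicallyCompatible hA hB hC⟩
  · simpa only [trianglePossible_rotate (A := A)] using shareThirdOutcome hB hC hA
  · simpa only [← trianglePossible_rotate (A := C)] using shareThirdOutcome hC hA hB

end Pattern

/-! ### Supports of triangle-local distributions -/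

section Support

open Finset

theorem triangle_sum_pos_iff {X Y Z : Type*} [Fintype X] [Fintype Y] [Fintype Z]
    {p : X → ℝ} {q : Y → ℝ} {r : Z → ℝ} {f : Y → Z → ℝ} {g : Z → X → ℝ} {h : X → Y → ℝ}
    (hp : ∀ x, 0 ≤ p x) (hq : ∀ y, 0 ≤ q y) (hr : ∀ z, 0 ≤ r z)
    (hf : ∀ y z, 0 ≤ f y z) (hg : ∀ z x, 0 ≤ g z x) (hh : ∀ x y, 0 ≤ h x y) :
    0 < ∑ x, ∑ y, ∑ z, p x * q y * r z * f y z * g z x * h x y ↔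
      ∃ x y z, 0 < p x ∧ 0 < q y ∧ 0 < r z ∧ 0 < f y z ∧ 0 < g z x ∧ 0 < h x y := by
  have hnn : ∀ x y z, 0 ≤ p x * q y * r z * f y z * g z x * h x y := fun x y z => by
    have := hp x; have := hq y; have := hr z; have := hf y z; have := hg z x; have := hh x y
    positivity
  rw [sum_pos_iff_of_nonneg fun x _ => sum_nonneg fun y _ => sum_nonneg fun z _ => hnn x y z]
  refine exists_congr fun x => ?_
  rw [sum_pos_iff_of_nonneg fun y _ => sum_nonneg fun z _ => hnn x y z]
  simp only [mem_univ, true_and]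
  refine exists_congr fun y => ?_
  rw [sum_pos_iff_of_nonneg fun z _ => hnn x y z]
  simp only [mem_univ, true_and]
  refine exists_congr fun z => ?_
  simp only [(hp x).lt_iff_ne', (hq y).lt_iff_ne', (hr z).lt_iff_ne', (hf y z).lt_iff_ne',
    (hg z x).lt_iff_ne', (hh x y).lt_iff_ne', (hnn x y z).lt_iff_ne', ne_eq, mul_eq_zero, not_or,
    and_assoc]

theorem exists_pos_of_sum_eq_one {ι : Type*} [Fintype ι] {f : ι → ℝ} (h : ∑ i, f i = 1) :
    ∃ i, 0 < f i := by
  by_contra! hf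
  linarith [sum_nonpos fun i (_ : i ∈ univ) => hf i]

theorem IsTriangleLocalWith.exists_trianglePossible {nα nβ nγ : ℕ} {P : Fin 2 → Fin 2 → Fin 2 → ℝ}
    (hP : IsTriangleLocalWith nα nβ nγ P) :
    ∃ (X Y Z : Type) (_ : Nonempty X) (_ : Nonempty Y) (_ : Nonempty Z)
      (A : Fin 2 → Y → Z → Prop) (B : Fin 2 → Z → X → Prop) (C : Fin 2 → X → Y → Prop),
      (∀ y z, ∃ a, A a y z) ∧ (∀ z x, ∃ b, B b z x) ∧ (∀ x y, ∃ c, C c x y) ∧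
      ∀ a b c, 0 < P a b c ↔ TrianglePossible A B C a b c := by
  obtain ⟨p, q, r, f, g, h, hp, hp1, hq, hq1, hr, hr1, hf, hf1, hg, hg1, hh, hh1, hP⟩ := hP
  refine ⟨{x // 0 < p x}, {y // 0 < q y}, {z // 0 < r z},
    nonempty_subtype.2 (exists_pos_of_sum_eq_one hp1),
    nonempty_subtype.2 (exists_pos_of_sum_eq_one hq1),
    nonempty_subtype.2 (exists_pos_of_sum_eq_one hr1),
    fun a y z => 0 < f a y z, fun b z x => 0 < g b z x, fun c x y => 0 < h c x y,
    fun y z => exists_pos_of_sum_eq_one (hf1 y z), fun z x => exists_pos_of_sum_eq_one (hg1 z x),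
    fun x y => exists_pos_of_sum_eq_one (hh1 x y), fun a b c => ?_⟩
  rw [hP, triangle_sum_pos_iff hp hq hr (hf a) (hg b) (hh c)]
  constructor
  · rintro ⟨x, y, z, hx, hy, hz, hpos⟩
    exact ⟨⟨x, hx⟩, ⟨y, hy⟩, ⟨z, hz⟩, hpos⟩
  · rintro ⟨⟨x, hx⟩, ⟨y, hy⟩, ⟨z, hz⟩, hpos⟩
    exact ⟨x, y, z, hx, hy, hz, hpos⟩

end Support

/-! ### Realizing patterns with binary sources -/

/-- The response `v` may produce the outcome `a`; the response `2` is a fair coin toss. -/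
abbrev MayProduce (v : Fin 3) (a : Fin 2) : Prop := v = 2 ∨ v.val = a.val

/-- The outcome probabilities of the response `v`. -/
noncomputable def responseProb (v : Fin 3) (a : Fin 2) : ℝ :=
  if v = 2 then 1 / 2 else if v.val = a.val then 1 else 0

theorem responseProb_nonneg (v : Fin 3) (a : Fin 2) : 0 ≤ responseProb v a := by
  unfold responseProb; split_ifs <;> norm_num

theorem responseProb_pos_iff (v : Fin 3) (a : Fin 2) : 0 < responseProb v a ↔ MayProduce v a := by
  unfold responseProb; split_ifs <;> simp [MayProduce, *]

theorem sum_responseProb (v : Fin 3) : ∑ a, responseProb v a = 1 := by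
  rw [Fin.sum_univ_two]
  fin_cases v <;> norm_num [responseProb, Fin.ext_iff]

theorem exists_isTriangleLocalWith_two (A B C : Fin 2 → Fin 2 → Fin 3) :
    ∃ Q, IsTriangleLocalWith 2 2 2 Q ∧ ∀ a b c, 0 < Q a b c ↔
      TrianglePossible (fun a y z => MayProduce (A y z) a) (fun b z x => MayProduce (B z x) b)
        (fun c x y => MayProduce (C x y) c) a b c := by
  refine ⟨_, ⟨fun _ => 1 / 2, fun _ => 1 / 2, fun _ => 1 / 2, fun a y z => responseProb (A y z) a,
    fun b z x => responseProb (B z x) b, fun c x y => responseProb (C x y) c, by norm_num,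
    by norm_num, by norm_num, by norm_num, by norm_num, by norm_num,
    fun _ _ _ => responseProb_nonneg _ _, fun _ _ => sum_responseProb _,
    fun _ _ _ => responseProb_nonneg _ _, fun _ _ => sum_responseProb _,
    fun _ _ _ => responseProb_nonneg _ _, fun _ _ => sum_responseProb _,
    fun _ _ _ => rfl⟩, fun a b c => ?_⟩
  rw [triangle_sum_pos_iff (by norm_num) (by norm_num) (by norm_num)
    (fun _ _ => responseProb_nonneg _ _) (fun _ _ => responseProb_nonneg _ _)
    (fun _ _ => responseProb_nonneg _ _)]
  simp [responseProb_pos_iff, TrianglePossible]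

/-- The pattern whose possible outcomes are the positions of the binary digits `1` of `m`. -/
abbrev BitPattern (m : ℕ) (a b c : Fin 2) : Prop := m.testBit (4 * a + 2 * b + c) = true

theorem exists_bitPattern (T : Fin 2 → Fin 2 → Fin 2 → Prop) : ∃ m < 256, T = BitPattern m := by
  classical
  let f (i : Fin 8) : Bool := decide (T (Fin.ofNat 2 (i / 4)) (Fin.ofNat 2 (i / 2)) (Fin.ofNat 2 i))
  refine ⟨Nat.ofBits f, Nat.ofBits_lt_two_pow f, ?_⟩
  ext a b c
  have hlt : 4 * (a : ℕ) + 2 * b + c < 8 := by omega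
  have ha : Fin.ofNat 2 ((4 * (a : ℕ) + 2 * b + c) / 4) = a := Fin.ext (by simp; omega)
  have hb : Fin.ofNat 2 ((4 * (a : ℕ) + 2 * b + c) / 2) = b := Fin.ext (by simp; omega)
  have hc : Fin.ofNat 2 (4 * (a : ℕ) + 2 * b + c) = c := Fin.ext (by simp; omega)
  rw [BitPattern, Nat.testBit_ofBits_lt f _ hlt, decide_eq_true_iff, ha, hb, hc]

/-- The `i`-th ternary digit of `n`. -/
def ternaryDigit (n i : ℕ) : Fin 3 := Fin.ofNat 3 (n / 3 ^ i)

/-- The `m`-th entry encodes, by ternary digits, binary-source responses realizing `BitPattern m`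
whenever this is possible. -/
def binarySourceCodes : List ℕ :=
  [0, 0, 262440, 177147, 3240, 2187, 28674, 21870, 265680, 238626, 264627, 238383, 180387,
   179577, 205821, 179334, 40, 27, 65646, 59076, 354, 270, 0, 6831, 0, 0, 0, 0, 0, 0, 65961,
   59319, 262480, 196866, 262467, 196857, 0, 0, 0, 0, 262794, 0, 262710, 256149, 0, 197181,
   0, 197100, 177187, 177183, 242793, 177174, 0, 0, 26517, 19953, 0, 236469, 0, 236466,
   177501, 177417, 85563, 413613, 3280, 2946, 0, 0, 3267, 2943, 0, 0, 68886, 0, 0, 68553,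
   62316, 62235, 0, 61992, 2227, 2217, 0, 0, 2541, 2214, 9027, 8775, 0, 61515, 67833, 61263,
   0, 61506, 9099, 120312, 28714, 0, 0, 28461, 0, 22149, 28701, 21897, 0, 81198, 87759,
   80946, 28785, 178146, 87750, 139995, 21910, 21909, 0, 21900, 0, 21906, 48393, 41580,
   65973, 100881, 87516, 100629, 22224, 355293, 89937, 159678, 265720, 0, 265386, 0, 200106,
   0, 0, 199773, 265707, 0, 265383, 0, 200097, 0, 206577, 258822, 238666, 0, 0, 238413, 0,
   179613, 186174, 179361, 0, 238653, 245223, 238410, 238737, 179604, 86292, 297459, 264667,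
   0, 264657, 0, 0, 199053, 205857, 199044, 264981, 258345, 264654, 258093, 0, 199368,
   205848, 317142, 238423, 0, 244983, 258096, 197193, 179370, 225540, 218727, 0, 278028,
   244980, 277776, 258420, 181791, 440586, 336825, 180427, 0, 0, 180093, 180423, 0, 29433,
   180090, 246033, 239385, 0, 245700, 180414, 180333, 29430, 239139, 179617, 0, 68565,
   179364, 179697, 356760, 363321, 356508, 0, 415809, 422370, 415557, 179688, 356751, 90666,
   474606, 205861, 199785, 0, 205608, 0, 376443, 383004, 376191, 87843, 435492, 442053,
   435240, 205932, 182520, 382995, 494289, 179374, 179373, 67836, 199047, 177510, 356517,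
   402687, 395874, 243120, 455175, 422127, 454923, 199371, 358938, 444231, 513972]

theorem trianglePossible_binarySourceCodes : ∀ m < 256,
    (∀ a b c, TrianglePossible
      (fun a (y z : Fin 2) => MayProduce (ternaryDigit (binarySourceCodes.getD m 0) (2 * y + z)) a)
      (fun b (z x : Fin 2) =>
        MayProduce (ternaryDigit (binarySourceCodes.getD m 0) (4 + 2 * z + x)) b)
      (fun c (x y : Fin 2) =>
        MayProduce (ternaryDigit (binarySourceCodes.getD m 0) (8 + 2 * x + y)) c)
      a b c ↔ BitPattern m a b c) ∨
    ¬TriangleCompatible (BitPattern m) := by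
  decide +kernel

/-- In the triangle scenario with binary outcomes, hidden variables of
cardinality 2 suffice at the possibilistic level: every distribution that is
triangle-local with sources of cardinality 6 has the same support as some
distribution that is triangle-local with sources of cardinality 2. -/
theorem triangle_pattern_cardinality_two_suffices
    (P : Fin 2 → Fin 2 → Fin 2 → ℝ) (hP : IsTriangleLocalWith 6 6 6 P) :
    ∃ Q : Fin 2 → Fin 2 → Fin 2 → ℝ, IsTriangleLocalWith 2 2 2 Q ∧
      ∀ a b c, (0 < Q a b c ↔ 0 < P a b c) := by
  obtain ⟨X, Y, Z, _, _, _, A, B, C, hA, hB, hC, hP⟩ := hP.exists_trianglePossible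
  obtain ⟨m, hm, hT⟩ := exists_bitPattern (TrianglePossible A B C)
  have hcompat := hT ▸ TrianglePossible.triangleCompatible hA hB hC
  obtain ⟨Q, hQ, hQpos⟩ := exists_isTriangleLocalWith_two
    (fun y z => ternaryDigit (binarySourceCodes.getD m 0) (2 * y + z))
    (fun z x => ternaryDigit (binarySourceCodes.getD m 0) (4 + 2 * z + x))
    (fun x y => ternaryDigit (binarySourceCodes.getD m 0) (8 + 2 * x + y))
  refine ⟨Q, hQ, fun a b c => ?_⟩
  rw [hQpos, hP, hT]
  exact ((trianglePossible_binarySourceCodes m hm).resolve_right (not_not_intro hcompat)) a b c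
end
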